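/- Let α, β > −1 with (α,β) ≠ (−1/2,−1/2). Then the second-order Riesz–Jacobi transform R_2 is not bounded on L¹(dμ): there is no constant C such that ∫₀^π |R_2 f(θ)| dμ(θ) ≤ C ∫₀^π |f(θ)| dμ(θ) for all f ∈ C_c^∞(0,π). -/

import Mathlib

open MeasureTheory Real Set Filter
open scoped Classical

noncomputable section

/-- The Jacobi measure dμ_{α,β} on (0,π). -/
def jacobiMeasure (α β : ℝ) : Measure ℝ :=
  (volume.restrict (Set.Ioo 0 π)).withDensity
    (fun θ => ENNReal.ofReal ((Real.sin (θ/2)) ^ (2*α+1) * (Real.cos (θ/2)) ^ (2*β+1)))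

/-- The classical Jacobi polynomial `P_n^{(α,β)}`. -/
def jacobiPoly (α β : ℝ) (n : ℕ) (x : ℝ) : ℝ :=
  ∑ k ∈ Finset.range (n+1),
    (Real.Gamma ((n:ℝ)+α+1) / (Real.Gamma (α+(k:ℝ)+1) * (Nat.factorial (n-k)))) *
    (Real.Gamma ((n:ℝ)+β+1) / (Real.Gamma ((n:ℝ)+β-(k:ℝ)+1) * (Nat.factorial k))) *
    ((x-1)/2)^k * ((x+1)/2)^(n-k)

/-- Normalized trigonometric Jacobi polynomial `𝒫_n(θ) = c_n P_n^{(α,β)}(cos θ)`. -/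
def nJacobi (α β : ℝ) (c : ℕ → ℝ) (n : ℕ) (θ : ℝ) : ℝ :=
  c n * jacobiPoly α β n (Real.cos θ)

def jacobiTau (α β : ℝ) : ℝ := (α + β + 1) / 2

/-- `c` is an admissible sequence of (positive) normalizing constants. -/
def JacobiNormalized (α β : ℝ) (c : ℕ → ℝ) : Prop :=
  (∀ n, 0 < c n) ∧
  ∀ n, ∫ θ, (nJacobi α β c n θ)^2 ∂(jacobiMeasure α β) = 1

/-- The Jacobi-Poisson kernel. -/
def poissonKer (α β : ℝ) (c : ℕ → ℝ) (t θ φ : ℝ) : ℝ :=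
  ∑' n : ℕ, Real.exp (-t * |(n:ℝ) + jacobiTau α β|) * nJacobi α β c n θ * nJacobi α β c n φ

/-- The Riesz-Jacobi kernel of order `N`. -/
def rieszKer (α β : ℝ) (c : ℕ → ℝ) (N : ℕ) (θ φ : ℝ) : ℝ :=
  (1 / Real.Gamma (N:ℝ)) *
    ∫ t in Set.Ioi (0:ℝ), iteratedDeriv N (fun θ' => poissonKer α β c t θ' φ) θ * t ^ (N-1)

/-- Inner product in `L²(dμ_{α,β})`. -/
def jacobiInner (α β : ℝ) (f g : ℝ → ℝ) : ℝ := ∫ θ, f θ * g θ ∂(jacobiMeasure α β)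

/-- The Riesz-Jacobi transform of order `N` on test functions. -/
def rieszTransform (α β : ℝ) (c : ℕ → ℝ) (N : ℕ) (f : ℝ → ℝ) (θ : ℝ) : ℝ :=
  ∑' n : ℕ, |((n:ℝ)+1) + jacobiTau α β| ^ (-(N:ℝ)) *
    jacobiInner α β f (nJacobi α β c (n+1)) *
    iteratedDeriv N (nJacobi α β c (n+1)) θ

/-- `f ∈ C_c^∞(0,π)`. -/
def IsCcSmooth (f : ℝ → ℝ) : Prop :=
  ContDiff ℝ (⊤ : ℕ∞) f ∧ HasCompactSupport f ∧ tsupport f ⊆ Set.Ioo 0 π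

/-- eigenvalue -/
def jLam (α β : ℝ) (n : ℕ) : ℝ := (n:ℝ) * ((n:ℝ) + α + β + 1)

/-- coefficient -/
def jCoef (α β : ℝ) (n k : ℕ) : ℝ :=
    (Real.Gamma ((n:ℝ)+α+1) / (Real.Gamma (α+(k:ℝ)+1) * (Nat.factorial (n-k)))) *
    (Real.Gamma ((n:ℝ)+β+1) / (Real.Gamma ((n:ℝ)+β-(k:ℝ)+1) * (Nat.factorial k)))

lemma jCoef_pos {α β : ℝ} (hα : -1 < α) (hβ : -1 < β) {n k : ℕ} (hk : k ≤ n) :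
    0 < jCoef α β n k := by
  have hk' : (k:ℝ) ≤ n := by exact_mod_cast hk
  have hk0 : (0:ℝ) ≤ k := by positivity
  unfold jCoef
  have h1 := Real.Gamma_pos_of_pos (show 0 < (n:ℝ)+α+1 by linarith)
  have h2 := Real.Gamma_pos_of_pos (show 0 < α+(k:ℝ)+1 by linarith)
  have h3 := Real.Gamma_pos_of_pos (show 0 < (n:ℝ)+β+1 by linarith)
  have h4 := Real.Gamma_pos_of_pos (show 0 < (n:ℝ)+β-(k:ℝ)+1 by linarith)
  positivity

lemma jCoef_rec {α β : ℝ} (hα : -1 < α) (hβ : -1 < β) {n k : ℕ} (hk : k < n) :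
    jCoef α β n (k+1) * (((k:ℝ)+1) * ((k:ℝ)+1+α)) =
      jCoef α β n k * ((((n-k:ℕ):ℝ)) * (((n-k:ℕ):ℝ)+β)) := by
  obtain ⟨m, rfl⟩ : ∃ m, n = k + 1 + m := ⟨n-(k+1), by omega⟩
  have e1 : k + 1 + m - (k+1) = m := by omega
  have e2 : k + 1 + m - k = m + 1 := by omega
  have hk0 : (0:ℝ) ≤ k := by positivity
  have hm0 : (0:ℝ) ≤ m := by positivity
  unfold jCoef
  rw [e1, e2]
  have h2 := Real.Gamma_pos_of_pos (show 0 < α+(k:ℝ)+1 by linarith)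
  have h4 := Real.Gamma_pos_of_pos (show 0 < (m:ℝ)+β+1 by linarith)
  have g1 : Real.Gamma (α + ((k+1:ℕ):ℝ) + 1) = (α+k+1) * Real.Gamma (α+k+1) := by
    rw [← Real.Gamma_add_one (by linarith)]; push_cast; ring_nf
  have g2 : Real.Gamma (((k+1+m:ℕ):ℝ) + β - k + 1) = (m+β+1) * Real.Gamma (m+β+1) := by
    rw [← Real.Gamma_add_one (by linarith)]; push_cast; ring_nf
  have g3 : Real.Gamma (((k+1+m:ℕ):ℝ) + β - ((k+1:ℕ):ℝ) + 1) = Real.Gamma (m+β+1) := by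
    push_cast; ring_nf
  rw [g1, g2, g3, Nat.factorial_succ, Nat.factorial_succ]
  have : α + k + 1 ≠ 0 := by linarith
  have : (m:ℝ) + β + 1 ≠ 0 := by linarith
  have := h2.ne'
  have := h4.ne'
  push_cast
  field_simp
  ring

open Polynomial in
/-- Jacobi polynomial as polynomial -/
def jPol (α β : ℝ) (n : ℕ) : ℝ[X] :=
  ∑ k ∈ Finset.range (n+1), C (jCoef α β n k / 2^n) * ((X - C 1)^k * (X + C 1)^(n-k))

lemma jPol_eval (α β : ℝ) (n : ℕ) (x : ℝ) : (jPol α β n).eval x = jacobiPoly α β n x := by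
  unfold jPol jacobiPoly
  rw [Polynomial.eval_finsetSum]
  refine Finset.sum_congr rfl fun k hk => ?_
  have hk : k ≤ n := by simpa [Nat.lt_succ_iff] using hk
  have : (2:ℝ)^n = 2^k * 2^(n-k) := by rw [← pow_add]; congr 1; omega
  simp only [Polynomial.eval_mul, Polynomial.eval_C, Polynomial.eval_pow, Polynomial.eval_sub,
    Polynomial.eval_add, Polynomial.eval_X, div_pow, this]
  unfold jCoef
  field_simp

lemma jPol_degree {α β : ℝ} (hα : -1 < α) (hβ : -1 < β) (n : ℕ) :
    (jPol α β n).degree = n := by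
  have hmon : ∀ k ∈ Finset.range (n+1), ((Polynomial.X - Polynomial.C (1:ℝ))^k *
      (Polynomial.X + Polynomial.C 1)^(n-k)).Monic ∧ ((Polynomial.X - Polynomial.C (1:ℝ))^k *
      (Polynomial.X + Polynomial.C 1)^(n-k)).natDegree = n := by
    intro k hk
    have hk : k ≤ n := by simpa [Nat.lt_succ_iff] using hk
    have m1 := (Polynomial.monic_X_sub_C (1:ℝ)).pow k
    have m2 := (Polynomial.monic_X_add_C (1:ℝ)).pow (n-k)
    refine ⟨m1.mul m2, ?_⟩
    rw [m1.natDegree_mul m2, Polynomial.natDegree_pow, Polynomial.natDegree_pow,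
      Polynomial.natDegree_X_sub_C, Polynomial.natDegree_X_add_C]
    omega
  have hc : 0 < (jPol α β n).coeff n := by
    unfold jPol
    rw [Polynomial.finsetSum_coeff]
    refine Finset.sum_pos (fun k hk => ?_) ⟨0, by simp⟩
    obtain ⟨h1, h2⟩ := hmon k hk
    rw [Polynomial.coeff_C_mul]
    have : ((Polynomial.X - Polynomial.C (1:ℝ))^k *
      (Polynomial.X + Polynomial.C 1)^(n-k)).coeff n = 1 := by
      have := h1.coeff_natDegree
      rwa [h2] at this
    rw [this]
    have := jCoef_pos hα hβ (n := n) (k := k) (by simpa [Nat.lt_succ_iff] using hk)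
    positivity
  apply Polynomial.degree_eq_of_le_of_coeff_ne_zero _ hc.ne'
  unfold jPol
  refine (Polynomial.degree_sum_le _ _).trans ?_
  refine Finset.sup_le fun k hk => ?_
  obtain ⟨h1, h2⟩ := hmon k hk
  apply Polynomial.degree_le_of_natDegree_le
  exact (Polynomial.natDegree_C_mul_le _ _).trans h2.le

open Polynomial in
/-- Jacobi operator on polynomials, evaluated -/
def jOp (α β l : ℝ) (p : ℝ[X]) (x : ℝ) : ℝ :=
  (1 - x^2) * (derivative (derivative p)).eval x + (β - α - (α+β+2)*x) * (derivative p).eval x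
    + l * p.eval x

open Polynomial in
lemma jOp_term (α β : ℝ) (k m : ℕ) (x : ℝ) :
    jOp α β (((k:ℝ)+m) * ((k:ℝ)+m+α+β+1)) ((X - C 1)^k * (X + C 1)^m) x =
      2 * ((m:ℝ)*(m+β) * ((x-1)^k*(x+1)^(m-1))) - 2 * ((k:ℝ)*(k+α) * ((x-1)^(k-1) * (x+1)^m)) := by
  unfold jOp
  rcases k with _ | _ | k <;> rcases m with _ | _ | m <;>
  · simp [derivative_mul, derivative_pow]
    try ring

open Polynomial in
lemma jOp_sum (α β l x : ℝ) (s : Finset ℕ) (a : ℕ → ℝ) (p : ℕ → ℝ[X]) :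
    jOp α β l (∑ k ∈ s, C (a k) * p k) x = ∑ k ∈ s, a k * jOp α β l (p k) x := by
  unfold jOp
  simp only [derivative_sum, eval_finsetSum, derivative_C_mul, eval_mul, eval_C, Finset.mul_sum,
    ← Finset.sum_add_distrib]
  refine Finset.sum_congr rfl fun k _ => ?_
  ring

open Polynomial in
lemma jPol_ode {α β : ℝ} (hα : -1 < α) (hβ : -1 < β) (n : ℕ) (x : ℝ) :
    jOp α β (jLam α β n) (jPol α β n) x = 0 := by
  unfold jPol
  rw [jOp_sum]
  have h1 : ∀ k ∈ Finset.range (n+1), jCoef α β n k / 2^n *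
      jOp α β (jLam α β n) ((X - C 1)^k * (X + C 1)^(n-k)) x =
      2/2^n * (jCoef α β n k * (((n-k:ℕ):ℝ)*((n-k:ℕ)+β)) * ((x-1)^k*(x+1)^(n-k-1))) -
      2/2^n * (jCoef α β n k * ((k:ℝ)*(k+α)) * ((x-1)^(k-1) * (x+1)^(n-k))) := by
    intro k hk
    have hk : k ≤ n := by simpa [Nat.lt_succ_iff] using hk
    have := jOp_term α β k (n-k) x
    have e : (k:ℝ) + ((n-k:ℕ):ℝ) = n := by push_cast [hk]; ring
    rw [e] at this
    unfold jLam
    rw [this]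
    ring
  rw [Finset.sum_congr rfl h1, Finset.sum_sub_distrib, ← Finset.mul_sum, ← Finset.mul_sum,
    Finset.sum_range_succ, Finset.sum_range_succ' (n := n), ← mul_sub]
  apply mul_eq_zero_of_right
  simp only [Nat.sub_self, Nat.cast_zero, zero_mul, mul_zero, add_zero]
  rw [← Finset.sum_sub_distrib]
  apply Finset.sum_eq_zero
  intro k hk
  have hk : k < n := by simpa using hk
  have := jCoef_rec hα hβ hk
  push_cast
  rw [this, Nat.sub_sub]
  simp

/-- weight -/
def jW (α β : ℝ) (θ : ℝ) : ℝ := (Real.sin (θ/2)) ^ (2*α+1) * (Real.cos (θ/2)) ^ (2*β+1)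

/-- drift -/
def jD (α β : ℝ) (θ : ℝ) : ℝ := ((α - β) + (α+β+1) * Real.cos θ) / Real.sin θ

lemma sin_half_pos {θ : ℝ} (h : θ ∈ Ioo 0 π) : 0 < Real.sin (θ/2) :=
  Real.sin_pos_of_pos_of_lt_pi (by linarith [h.1]) (by linarith [h.2, Real.pi_pos])

lemma cos_half_pos {θ : ℝ} (h : θ ∈ Ioo 0 π) : 0 < Real.cos (θ/2) :=
  Real.cos_pos_of_mem_Ioo ⟨by linarith [h.1, Real.pi_pos], by linarith [h.2]⟩

lemma jW_pos (α β : ℝ) {θ : ℝ} (h : θ ∈ Ioo 0 π) : 0 < jW α β θ :=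
  mul_pos (Real.rpow_pos_of_pos (sin_half_pos h) _) (Real.rpow_pos_of_pos (cos_half_pos h) _)

lemma jW_measurable (α β : ℝ) : Measurable (jW α β) := by
  unfold jW; fun_prop

lemma jW_hasDerivAt (α β : ℝ) {θ : ℝ} (h : θ ∈ Ioo 0 π) :
    HasDerivAt (jW α β) (jD α β θ * jW α β θ) θ := by
  have hs := sin_half_pos h
  have hc := cos_half_pos h
  have d1 : HasDerivAt (fun θ : ℝ => Real.sin (θ/2)) (Real.cos (θ/2) * (1/2)) θ :=
    ((hasDerivAt_id θ).div_const 2).sin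
  have d2 : HasDerivAt (fun θ : ℝ => Real.cos (θ/2)) (-Real.sin (θ/2) * (1/2)) θ :=
    ((hasDerivAt_id θ).div_const 2).cos
  have e1 := d1.rpow_const (p := 2*α+1) (Or.inl hs.ne')
  have e2 := d2.rpow_const (p := 2*β+1) (Or.inl hc.ne')
  have e3 := e1.mul e2
  refine e3.congr_deriv ?_
  have hsin : Real.sin θ = 2 * Real.sin (θ/2) * Real.cos (θ/2) := by
    rw [← Real.sin_two_mul]; ring_nf
  have hcos : Real.cos θ = Real.cos (θ/2)^2 - Real.sin (θ/2)^2 := by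
    rw [← Real.cos_two_mul']; ring_nf
  have hone := Real.sin_sq_add_cos_sq (θ/2)
  unfold jD jW
  rw [hsin, hcos, Real.rpow_sub_one hs.ne', Real.rpow_sub_one hc.ne']
  set S := Real.sin (θ/2)
  set C := Real.cos (θ/2)
  have : α - β = (α-β)*(S^2+C^2) := by rw [hone]; ring
  rw [this]
  field_simp
  ring

lemma jW_continuousOn (α β : ℝ) : ContinuousOn (jW α β) (Ioo 0 π) :=
  fun _ h => (jW_hasDerivAt α β h).continuousAt.continuousWithinAt

lemma sin_pos_Ioo {θ : ℝ} (h : θ ∈ Ioo 0 π) : 0 < Real.sin θ :=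
  Real.sin_pos_of_pos_of_lt_pi h.1 h.2

lemma jD_contDiffOn (α β : ℝ) : ContDiffOn ℝ (⊤ : ℕ∞) (jD α β) (Ioo 0 π) := by
  unfold jD
  apply ContDiffOn.div
  · exact (contDiff_const.add (contDiff_const.mul Real.contDiff_cos)).contDiffOn
  · exact Real.contDiff_sin.contDiffOn
  · exact fun x hx => (sin_pos_Ioo hx).ne'

lemma jD_continuousOn (α β : ℝ) : ContinuousOn (jD α β) (Ioo 0 π) :=
  (jD_contDiffOn α β).continuousOn

/-- first derivative -/
def jY1 (α β : ℝ) (c : ℕ → ℝ) (n : ℕ) (θ : ℝ) : ℝ :=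
  -(c n * (Polynomial.derivative (jPol α β n)).eval (Real.cos θ) * Real.sin θ)

/-- second derivative -/
def jY2 (α β : ℝ) (c : ℕ → ℝ) (n : ℕ) (θ : ℝ) : ℝ :=
  c n * ((Polynomial.derivative (Polynomial.derivative (jPol α β n))).eval (Real.cos θ) *
    Real.sin θ ^2 - (Polynomial.derivative (jPol α β n)).eval (Real.cos θ) * Real.cos θ)

lemma nJacobi_eq (α β : ℝ) (c : ℕ → ℝ) (n : ℕ) :
    nJacobi α β c n = fun θ => c n * (jPol α β n).eval (Real.cos θ) := by
  funext θ
  rw [jPol_eval]; rfl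

lemma nJacobi_hasDerivAt (α β : ℝ) (c : ℕ → ℝ) (n : ℕ) (θ : ℝ) :
    HasDerivAt (nJacobi α β c n) (jY1 α β c n θ) θ := by
  rw [nJacobi_eq]
  have := (((jPol α β n).hasDerivAt (Real.cos θ)).comp θ (Real.hasDerivAt_cos θ)).const_mul (c n)
  refine this.congr_deriv ?_
  unfold jY1; ring

lemma jY1_hasDerivAt (α β : ℝ) (c : ℕ → ℝ) (n : ℕ) (θ : ℝ) :
    HasDerivAt (jY1 α β c n) (jY2 α β c n θ) θ := by
  have h1 := (((Polynomial.derivative (jPol α β n)).hasDerivAt (Real.cos θ)).comp θ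
    (Real.hasDerivAt_cos θ)).const_mul (c n)
  have := (h1.mul (Real.hasDerivAt_sin θ)).neg
  refine this.congr_deriv ?_
  unfold jY2; simp only [Function.comp]; ring

lemma nJacobi_iteratedDeriv (α β : ℝ) (c : ℕ → ℝ) (n : ℕ) :
    iteratedDeriv 2 (nJacobi α β c n) = jY2 α β c n := by
  rw [iteratedDeriv_succ, iteratedDeriv_one]
  have : deriv (nJacobi α β c n) = jY1 α β c n :=
    funext fun θ => (nJacobi_hasDerivAt α β c n θ).deriv
  rw [this]
  exact funext fun θ => (jY1_hasDerivAt α β c n θ).deriv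

lemma jY_ode {α β : ℝ} (hα : -1 < α) (hβ : -1 < β) (c : ℕ → ℝ) (n : ℕ) {θ : ℝ}
    (h : θ ∈ Ioo 0 π) : jY2 α β c n θ =
      -(jLam α β n * nJacobi α β c n θ) - jD α β θ * jY1 α β c n θ := by
  have h1 := jPol_ode hα hβ n (Real.cos θ)
  unfold jOp at h1
  have hs := sin_pos_Ioo h
  have h2 := Real.sin_sq_add_cos_sq θ
  rw [nJacobi_eq]
  unfold jY2 jY1 jD
  have e : 1 - Real.cos θ ^2 = Real.sin θ^2 := by linarith
  rw [e] at h1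
  field_simp
  linear_combination c n * h1

lemma nJacobi_continuous (α β : ℝ) (c : ℕ → ℝ) (n : ℕ) : Continuous (nJacobi α β c n) := by
  rw [nJacobi_eq]; fun_prop

lemma jY1_continuous (α β : ℝ) (c : ℕ → ℝ) (n : ℕ) : Continuous (jY1 α β c n) := by
  unfold jY1; fun_prop

lemma jY2_continuous (α β : ℝ) (c : ℕ → ℝ) (n : ℕ) : Continuous (jY2 α β c n) := by
  unfold jY2; fun_prop

lemma jMeasure_eq (α β : ℝ) : jacobiMeasure α β =
    (volume.restrict (Set.Ioo 0 π)).withDensity (fun θ => ENNReal.ofReal (jW α β θ)) := rfl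

lemma jInt_eq' (α β : ℝ) (f : ℝ → ℝ) :
    ∫ θ, f θ ∂(jacobiMeasure α β) = ∫ θ in Ioo 0 π, jW α β θ * f θ := by
  rw [jMeasure_eq]
  rw [integral_withDensity_eq_integral_toReal_smul (jW_measurable α β).ennreal_ofReal
    (by simp)]
  refine setIntegral_congr_fun measurableSet_Ioo fun θ h => ?_
  have := (jW_pos α β h).le
  simp only [smul_eq_mul]
  rw [ENNReal.toReal_ofReal this]

lemma jInt_eq (α β : ℝ) (f : ℝ → ℝ) :
    ∫ θ, f θ ∂(jacobiMeasure α β) = ∫ θ in (0:ℝ)..π, jW α β θ * f θ := by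
  rw [jInt_eq', intervalIntegral.integral_of_le Real.pi_pos.le, integral_Ioc_eq_integral_Ioo]

lemma jIntegrable_iff (α β : ℝ) (f : ℝ → ℝ) :
    Integrable f (jacobiMeasure α β) ↔ IntegrableOn (fun θ => jW α β θ * f θ) (Ioo 0 π) := by
  rw [jMeasure_eq]
  rw [integrable_withDensity_iff_integrable_smul' (jW_measurable α β).ennreal_ofReal (by simp)]
  apply integrableOn_congr_fun _ measurableSet_Ioo
  intro θ h
  have := (jW_pos α β h).le
  simp only [smul_eq_mul]
  rw [ENNReal.toReal_ofReal this]

lemma jFinite {α β : ℝ} {c : ℕ → ℝ} (hc : JacobiNormalized α β c) :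
    IsFiniteMeasure (jacobiMeasure α β) := by
  have h := hc.2 0
  have : ∀ θ, (nJacobi α β c 0 θ)^2 = (nJacobi α β c 0 0)^2 := by
    intro θ; simp [nJacobi, jacobiPoly]
  simp only [this, integral_const, smul_eq_mul] at h
  by_contra hcon
  have h2 : (jacobiMeasure α β) univ = ⊤ := by
    by_contra h3
    exact hcon ⟨lt_top_iff_ne_top.2 h3⟩
  simp [Measure.real, h2] at h

lemma jae_Ioo (α β : ℝ) : ∀ᵐ θ ∂(jacobiMeasure α β), θ ∈ Ioo 0 π := by
  unfold jacobiMeasure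
  exact (withDensity_absolutelyContinuous _ _).ae_le (ae_restrict_mem measurableSet_Ioo)

lemma jIntegrable_of_cont {α β : ℝ} {c : ℕ → ℝ} (hc : JacobiNormalized α β c) {f : ℝ → ℝ}
    (hf : Continuous f) : Integrable f (jacobiMeasure α β) := by
  have := jFinite hc
  obtain ⟨K, hK⟩ := (isCompact_Icc (a := (0:ℝ)) (b := π)).exists_bound_of_continuousOn
    hf.continuousOn
  refine Integrable.of_bound hf.aestronglyMeasurable K ?_
  filter_upwards [jae_Ioo α β] with θ h using hK θ ⟨h.1.le, h.2.le⟩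

lemma jInterval_of_cont {α β : ℝ} {c : ℕ → ℝ} (hc : JacobiNormalized α β c) {f : ℝ → ℝ}
    (hf : Continuous f) : IntervalIntegrable (fun θ => jW α β θ * f θ) volume 0 π := by
  rw [intervalIntegrable_iff_integrableOn_Ioo_of_le Real.pi_pos.le]
  exact (jIntegrable_iff α β f).1 (jIntegrable_of_cont hc hf)

lemma jGreen {α β : ℝ} (hα : -1 < α) (hβ : -1 < β) {c : ℕ → ℝ} (hc : JacobiNormalized α β c)
    (n m : ℕ) : ∫ θ, jY1 α β c n θ * jY1 α β c m θ ∂(jacobiMeasure α β) =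
      jLam α β n * ∫ θ, nJacobi α β c n θ * nJacobi α β c m θ ∂(jacobiMeasure α β) := by
  rw [← integral_const_mul, ← sub_eq_zero, ← integral_sub, jInt_eq]
  rotate_left
  · exact jIntegrable_of_cont hc ((jY1_continuous _ _ _ _).mul (jY1_continuous _ _ _ _))
  · exact jIntegrable_of_cont hc (continuous_const.mul
      ((nJacobi_continuous _ _ _ _).mul (nJacobi_continuous _ _ _ _)))
  set F : ℝ → ℝ := fun θ => -2 * c n * (Polynomial.derivative (jPol α β n)).eval (Real.cos θ) *
    (Real.sin (θ/2) ^ (2*α+2) * Real.cos (θ/2) ^ (2*β+2)) * nJacobi α β c m θ with hF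
  have hcont : ContinuousOn F (Icc 0 π) := by
    apply Continuous.continuousOn
    have h1 : Continuous fun θ : ℝ => Real.sin (θ/2) ^ (2*α+2) :=
      (by fun_prop : Continuous fun θ : ℝ => Real.sin (θ/2)).rpow_const
        (fun _ => Or.inr (by linarith))
    have h2 : Continuous fun θ : ℝ => Real.cos (θ/2) ^ (2*β+2) :=
      (by fun_prop : Continuous fun θ : ℝ => Real.cos (θ/2)).rpow_const
        (fun _ => Or.inr (by linarith))
    have h3 := nJacobi_continuous α β c m
    have h4 : Continuous fun θ : ℝ => (Polynomial.derivative (jPol α β n)).eval (Real.cos θ) := by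
      fun_prop
    exact ((continuous_const.mul h4).mul (h1.mul h2)).mul h3
  have hFeq : ∀ θ ∈ Ioo 0 π, F θ = jW α β θ * jY1 α β c n θ * nJacobi α β c m θ := by
    intro θ h
    have hs := sin_half_pos h
    have hc := cos_half_pos h
    have hsin : Real.sin θ = 2 * Real.sin (θ/2) * Real.cos (θ/2) := by
      rw [← Real.sin_two_mul]; ring_nf
    simp only [hF]
    unfold jW jY1
    rw [hsin, show 2*α+2 = (2*α+1)+1 by ring, show 2*β+2 = (2*β+1)+1 by ring,
      Real.rpow_add_one hs.ne', Real.rpow_add_one hc.ne']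
    ring
  have hder : ∀ θ ∈ Ioo 0 π, HasDerivAt F (jW α β θ * (jY1 α β c n θ * jY1 α β c m θ -
      jLam α β n * (nJacobi α β c n θ * nJacobi α β c m θ))) θ := by
    intro θ h
    have := ((jW_hasDerivAt α β h).mul (jY1_hasDerivAt α β c n θ)).mul
      (nJacobi_hasDerivAt α β c m θ)
    refine HasDerivAt.congr_of_eventuallyEq (this.congr_deriv ?_) ?_
    · simp only [Pi.mul_apply]
      rw [jY_ode hα hβ c n h]; ring
    · filter_upwards [isOpen_Ioo.mem_nhds h] with x hx using hFeq x hx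
  rw [intervalIntegral.integral_eq_sub_of_hasDerivAt_of_le Real.pi_pos.le hcont hder]
  · have a1 : (2*α+2) ≠ 0 := by linarith
    have a2 : (2*β+2) ≠ 0 := by linarith
    simp [hF, Real.zero_rpow a1, Real.zero_rpow a2]
  · apply jInterval_of_cont hc
    exact ((jY1_continuous _ _ _ _).mul (jY1_continuous _ _ _ _)).sub (continuous_const.mul
      ((nJacobi_continuous _ _ _ _).mul (nJacobi_continuous _ _ _ _)))

lemma jLam_mono {α β : ℝ} (hα : -1 < α) (hβ : -1 < β) {n m : ℕ} (h : n < m) :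
    jLam α β n < jLam α β m := by
  unfold jLam
  have h1 : (n:ℝ) + 1 ≤ m := by exact_mod_cast h
  have h0 : (0:ℝ) ≤ n := by positivity
  nlinarith [mul_nonneg h0 h0]

lemma jOrtho {α β : ℝ} (hα : -1 < α) (hβ : -1 < β) {c : ℕ → ℝ} (hc : JacobiNormalized α β c)
    (n m : ℕ) : ∫ θ, nJacobi α β c n θ * nJacobi α β c m θ ∂(jacobiMeasure α β) =
      if n = m then 1 else 0 := by
  split_ifs with h
  · subst h
    rw [← hc.2 n]
    simp only [sq]
  · have h1 := jGreen hα hβ hc n m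
    have h2 := jGreen hα hβ hc m n
    have e1 : ∀ θ, jY1 α β c m θ * jY1 α β c n θ = jY1 α β c n θ * jY1 α β c m θ :=
      fun θ => mul_comm _ _
    have e2 : ∀ θ, nJacobi α β c m θ * nJacobi α β c n θ = nJacobi α β c n θ * nJacobi α β c m θ :=
      fun θ => mul_comm _ _
    simp only [e1, e2] at h2
    rw [h1] at h2
    have h3 : jLam α β n ≠ jLam α β m := by
      rcases lt_or_gt_of_ne h with h | h
      · exact (jLam_mono hα hβ h).ne
      · exact (jLam_mono hα hβ h).ne'
    by_contra h4
    exact h3 (mul_right_cancel₀ h4 h2)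

lemma jEnergy {α β : ℝ} (hα : -1 < α) (hβ : -1 < β) {c : ℕ → ℝ} (hc : JacobiNormalized α β c)
    (n : ℕ) : ∫ θ, jY1 α β c n θ ^ 2 ∂(jacobiMeasure α β) = jLam α β n := by
  have := jGreen hα hβ hc n n
  rw [jOrtho hα hβ hc] at this
  simpa [sq] using this

lemma jLam_lower {α β : ℝ} (hα : -1 < α) (hβ : -1 < β) :
    ∃ δ > 0, ∀ n : ℕ, δ * (n:ℝ)^2 ≤ jLam α β n := by
  refine ⟨min 1 (α+β+2), lt_min one_pos (by linarith), fun n => ?_⟩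
  unfold jLam
  rcases n with _ | n
  · simp
  have h0 : (0:ℝ) ≤ n := by positivity
  set d := min 1 (α+β+2)
  have h1 : d ≤ 1 := min_le_left _ _
  have h2 : d ≤ α+β+2 := min_le_right _ _
  push_cast
  have : d * ((n:ℝ)+1) ≤ (n:ℝ)+1+α+β+1 := by nlinarith
  nlinarith

lemma jLam_nonneg {α β : ℝ} (hα : -1 < α) (hβ : -1 < β) (n : ℕ) : 0 ≤ jLam α β n := by
  obtain ⟨δ, hδ, h⟩ := jLam_lower hα hβ
  exact le_trans (by positivity) (h n)

/-- energy density -/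
def jQ (α β : ℝ) (c : ℕ → ℝ) (n : ℕ) (θ : ℝ) : ℝ :=
  jY1 α β c n θ ^ 2 + jLam α β n * nJacobi α β c n θ ^ 2

lemma jQ_continuous (α β : ℝ) (c : ℕ → ℝ) (n : ℕ) : Continuous (jQ α β c n) :=
  ((jY1_continuous _ _ _ _).pow 2).add (continuous_const.mul ((nJacobi_continuous _ _ _ _).pow 2))

lemma jQ_nonneg {α β : ℝ} (hα : -1 < α) (hβ : -1 < β) (c : ℕ → ℝ) (n : ℕ) (θ : ℝ) :
    0 ≤ jQ α β c n θ := by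
  have := jLam_nonneg hα hβ n
  unfold jQ; positivity

lemma jQ_hasDerivAt {α β : ℝ} (hα : -1 < α) (hβ : -1 < β) (c : ℕ → ℝ) (n : ℕ) {θ : ℝ}
    (h : θ ∈ Ioo 0 π) :
    HasDerivAt (jQ α β c n) (-2 * jD α β θ * jY1 α β c n θ ^ 2) θ := by
  have h1 := ((jY1_hasDerivAt α β c n θ).pow 2).add
    (((nJacobi_hasDerivAt α β c n θ).pow 2).const_mul (jLam α β n))
  refine h1.congr_deriv ?_
  rw [jY_ode hα hβ c n h]
  push_cast
  ring

lemma jQ_integral {α β : ℝ} (hα : -1 < α) (hβ : -1 < β) {c : ℕ → ℝ} (hc : JacobiNormalized α β c)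
    (n : ℕ) : ∫ θ, jQ α β c n θ ∂(jacobiMeasure α β) = 2 * jLam α β n := by
  unfold jQ
  rw [integral_add, integral_const_mul, hc.2 n, jEnergy hα hβ hc]
  · ring
  · exact jIntegrable_of_cont hc ((jY1_continuous _ _ _ _).pow 2)
  · exact jIntegrable_of_cont hc (continuous_const.mul ((nJacobi_continuous _ _ _ _).pow 2))

lemma Icc_sub_Ioo {a b : ℝ} (ha : 0 < a) (hb : b < π) : Icc a b ⊆ Ioo 0 π :=
  fun _ h => ⟨ha.trans_le h.1, h.2.trans_lt hb⟩

lemma jQ_compare {α β : ℝ} (hα : -1 < α) (hβ : -1 < β) (c : ℕ → ℝ) {a b K : ℝ}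
    (ha : 0 < a) (hb : b < π) (hK : ∀ θ ∈ Icc a b, |jD α β θ| ≤ K) (n : ℕ) {x y : ℝ}
    (hx : x ∈ Icc a b) (hy : y ∈ Icc a b) :
    jQ α β c n x ≤ Real.exp (2*K*π) * jQ α β c n y := by
  have hsub := Icc_sub_Ioo ha hb
  have hK0 : 0 ≤ K := (abs_nonneg _).trans (hK x hx)
  have hy1 : ∀ θ, jY1 α β c n θ ^ 2 ≤ jQ α β c n θ := by
    intro θ
    have := jLam_nonneg hα hβ n
    unfold jQ
    have : 0 ≤ jLam α β n * nJacobi α β c n θ ^ 2 := by positivity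
    linarith
  have hbd : ∀ θ ∈ Icc a b, |-2 * jD α β θ * jY1 α β c n θ ^ 2| ≤ 2 * K * jQ α β c n θ := by
    intro θ h
    have h1 := hK θ h
    have h2 := hy1 θ
    have h3 := abs_nonneg (jD α β θ)
    rw [abs_mul, abs_mul, abs_of_nonneg (sq_nonneg (jY1 α β c n θ))]
    norm_num
    have := sq_nonneg (jY1 α β c n θ)
    rw [mul_assoc, mul_assoc]
    gcongr
  have key : ∀ σ : ℝ, ∀ θ ∈ Ioo 0 π, HasDerivAt (fun θ => jQ α β c n θ * Real.exp (σ*θ))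
      ((-2 * jD α β θ * jY1 α β c n θ ^ 2 + σ * jQ α β c n θ) * Real.exp (σ*θ)) θ := by
    intro σ θ h
    have := (jQ_hasDerivAt hα hβ c n h).mul (((hasDerivAt_id θ).const_mul σ).exp)
    refine this.congr_deriv ?_
    simp; ring
  have hcont : ∀ σ : ℝ, ContinuousOn (fun θ => jQ α β c n θ * Real.exp (σ*θ)) (Icc a b) := by
    intro σ
    exact ((jQ_continuous α β c n).mul (by fun_prop)).continuousOn
  have hQy := jQ_nonneg hα hβ c n y
  have hx' := hsub hx
  have hy' := hsub hy
  rcases le_total x y with hxy | hxy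
  · have hm : MonotoneOn (fun θ => jQ α β c n θ * Real.exp ((2*K)*θ)) (Icc a b) := by
      refine monotoneOn_of_hasDerivWithinAt_nonneg (convex_Icc a b) (hcont _)
        (fun θ h => (key (2*K) θ (hsub (interior_subset h))).hasDerivWithinAt) ?_
      intro θ h
      have h1 := hbd θ (interior_subset h)
      have := (abs_le.1 h1).1
      have h2 : 0 ≤ -2 * jD α β θ * jY1 α β c n θ ^ 2 + 2*K * jQ α β c n θ := by linarith
      positivity
    have h := hm hx hy hxy
    simp only at h
    have h3 : jQ α β c n x ≤ jQ α β c n y * Real.exp (2*K*(y-x)) := by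
      rw [mul_sub, Real.exp_sub, ← mul_div_assoc, le_div_iff₀ (Real.exp_pos _)]
      exact h
    refine h3.trans ?_
    rw [mul_comm]
    gcongr
    linarith [hx'.1, hy'.2]
  · have hm : AntitoneOn (fun θ => jQ α β c n θ * Real.exp ((-(2*K))*θ)) (Icc a b) := by
      refine antitoneOn_of_hasDerivWithinAt_nonpos (convex_Icc a b) (hcont _)
        (fun θ h => (key (-(2*K)) θ (hsub (interior_subset h))).hasDerivWithinAt) ?_
      intro θ h
      have h1 := hbd θ (interior_subset h)
      have := (abs_le.1 h1).2
      have h2 : -2 * jD α β θ * jY1 α β c n θ ^ 2 + -(2*K) * jQ α β c n θ ≤ 0 := by linarith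
      exact mul_nonpos_of_nonpos_of_nonneg h2 (Real.exp_pos _).le
    have h := hm hy hx hxy
    simp only at h
    have h3 : jQ α β c n x ≤ jQ α β c n y * Real.exp (2*K*(x-y)) := by
      rw [neg_mul, neg_mul, Real.exp_neg, Real.exp_neg, ← div_eq_mul_inv, ← div_eq_mul_inv,
        div_le_iff₀ (Real.exp_pos _)] at h
      rw [mul_sub, Real.exp_sub]
      calc _ ≤ _ := h
        _ = _ := by ring
    refine h3.trans ?_
    rw [mul_comm]
    gcongr
    linarith [hy'.1, hx'.2]

lemma jQ_bound {α β : ℝ} (hα : -1 < α) (hβ : -1 < β) {c : ℕ → ℝ} (hc : JacobiNormalized α β c)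
    {a b : ℝ} (ha : 0 < a) (hab : a < b) (hb : b < π) :
    ∃ K, 0 ≤ K ∧ ∀ n, ∀ θ ∈ Icc a b, jQ α β c n θ ≤ K * jLam α β n := by
  have hsub := Icc_sub_Ioo ha hb
  obtain ⟨K, hK⟩ := (isCompact_Icc (a := a) (b := b)).exists_bound_of_continuousOn
    ((jD_continuousOn α β).mono hsub)
  obtain ⟨x0, hx0, hmin⟩ := (isCompact_Icc (a := a) (b := b)).exists_isMinOn
    (nonempty_Icc.2 hab.le) ((jW_continuousOn α β).mono hsub)
  set w0 := jW α β x0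
  have hw0 : 0 < w0 := jW_pos α β (hsub hx0)
  set E := Real.exp (2*K*π)
  have hba : 0 < b - a := by linarith
  refine ⟨2*E/(w0*(b-a)), by positivity, fun n θ hθ => ?_⟩
  have h1 : ∀ y ∈ Icc a b, w0 * jQ α β c n θ ≤ E * (jW α β y * jQ α β c n y) := by
    intro y hy
    have h := jQ_compare hα hβ c ha hb hK n hθ hy
    have h2 : w0 ≤ jW α β y := hmin hy
    have h3 := jQ_nonneg hα hβ c n θ
    have h4 := jQ_nonneg hα hβ c n y
    have hWy := (jW_pos α β (hsub hy)).le
    calc w0 * jQ α β c n θ ≤ jW α β y * (E * jQ α β c n y) := by gcongr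
      _ = _ := by ring
  have hInt : IntegrableOn (fun y => jW α β y * jQ α β c n y) (Ioo 0 π) :=
    (jIntegrable_iff α β _).1 (jIntegrable_of_cont hc (jQ_continuous α β c n))
  have h2 : ∫ y in Icc a b, w0 * jQ α β c n θ ≤ ∫ y in Icc a b, E * (jW α β y * jQ α β c n y) := by
    refine setIntegral_mono_on ?_ ?_ measurableSet_Icc h1
    · exact integrableOn_const (by simp)
    · exact (hInt.mono_set hsub).const_mul E
  have h3 : ∫ y in Icc a b, (jW α β y * jQ α β c n y) ≤ 2 * jLam α β n := by
    rw [← jQ_integral hα hβ hc n, jInt_eq']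
    refine setIntegral_mono_set hInt ?_ hsub.eventuallyLE
    filter_upwards [ae_restrict_mem measurableSet_Ioo] with y hy
    exact mul_nonneg (jW_pos α β hy).le (jQ_nonneg hα hβ c n y)
  rw [setIntegral_const, integral_const_mul] at h2
  have hv : volume.real (Icc a b) = b - a := by simp [hab.le]
  rw [hv, smul_eq_mul] at h2
  have hE : 0 < E := Real.exp_pos _
  have h4 : (b-a) * (w0 * jQ α β c n θ) ≤ E * (2 * jLam α β n) :=
    h2.trans (by gcongr)
  rw [div_mul_eq_mul_div, le_div_iff₀ (by positivity)]
  linarith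

lemma jY_bounds {α β : ℝ} (hα : -1 < α) (hβ : -1 < β) {c : ℕ → ℝ} (hc : JacobiNormalized α β c)
    {a b : ℝ} (ha : 0 < a) (hab : a < b) (hb : b < π) :
    ∃ K, 0 ≤ K ∧ ∀ n : ℕ, ∀ θ ∈ Icc a b, |nJacobi α β c (n+1) θ| ≤ K * jLam α β (n+1) ∧
      |jY1 α β c (n+1) θ| ≤ K * jLam α β (n+1) ∧ |jY2 α β c (n+1) θ| ≤ K * jLam α β (n+1) := by
  have hsub := Icc_sub_Ioo ha hb
  obtain ⟨K, hK0, hK⟩ := jQ_bound hα hβ hc ha hab hb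
  obtain ⟨M, hM⟩ := (isCompact_Icc (a := a) (b := b)).exists_bound_of_continuousOn
    ((jD_continuousOn α β).mono hsub)
  obtain ⟨δ, hδ, hlow⟩ := jLam_lower hα hβ
  have hM0 : 0 ≤ M := (norm_nonneg _).trans (hM a ⟨le_rfl, hab.le⟩)
  -- crude constants
  set A := K + 1
  have hA : 1 ≤ A := by simp only [A]; linarith
  refine ⟨A/δ + A*(1+1/δ) + (A + M * (A*(1+1/δ))), by positivity, fun n θ hθ => ?_⟩
  set l := jLam α β (n+1)
  have hl : δ ≤ l := by
    have := hlow (n+1)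
    push_cast at this
    have h0 : (0:ℝ) ≤ n := by positivity
    have : δ * 1 ≤ δ * ((n:ℝ)+1)^2 := by gcongr; nlinarith
    linarith
  have hl0 : 0 < l := hδ.trans_le hl
  have hq := hK (n+1) θ hθ
  unfold jQ at hq
  have hy : nJacobi α β c (n+1) θ ^2 ≤ A^2 := by
    have : l * nJacobi α β c (n+1) θ ^ 2 ≤ l * K := by
      nlinarith [sq_nonneg (jY1 α β c (n+1) θ)]
    have := le_of_mul_le_mul_left this hl0
    simp only [A]
    nlinarith
  have hy' : |nJacobi α β c (n+1) θ| ≤ A := abs_le_of_sq_le_sq hy (by linarith)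
  have hl1 : l ≤ (1+1/δ) * l := by
    have : 0 ≤ 1/δ * l := by positivity
    linarith
  have hone : 1 ≤ 1/δ * l := by rw [one_div, inv_mul_eq_div, le_div_iff₀ hδ]; linarith
  have hy1 : jY1 α β c (n+1) θ ^2 ≤ (A * ((1+1/δ) * l))^2 := by
    have h1 : jY1 α β c (n+1) θ ^2 ≤ K * l := by
      have : 0 ≤ l * nJacobi α β c (n+1) θ ^ 2 := by positivity
      linarith
    have h2 : K * l ≤ A^2 * l := by
      gcongr; simp only [A]; nlinarith
    have h3 : l ≤ ((1+1/δ) * l)^2 := by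
      have : 1 ≤ (1+1/δ)*l := by linarith
      nlinarith
    calc _ ≤ A^2 * l := h1.trans h2
      _ ≤ A^2 * ((1+1/δ) * l)^2 := by gcongr
      _ = _ := by ring
  have hy1' : |jY1 α β c (n+1) θ| ≤ A * ((1+1/δ) * l) :=
    abs_le_of_sq_le_sq hy1 (by positivity)
  have hy2 : |jY2 α β c (n+1) θ| ≤ l * A + M * (A * ((1+1/δ) * l)) := by
    rw [jY_ode hα hβ c (n+1) (hsub hθ)]
    have := hM θ hθ
    rw [Real.norm_eq_abs] at this
    refine (abs_sub _ _).trans ?_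
    rw [abs_neg, abs_mul, abs_mul, abs_of_pos hl0]
    gcongr
  have e1 : 0 ≤ A/δ * l := by positivity
  have e2 : 0 ≤ A*(1+1/δ)*l := by positivity
  have e3 : 0 ≤ (A + M * (A*(1+1/δ)))*l := by positivity
  refine ⟨?_, ?_, ?_⟩
  · have : A ≤ A/δ * l := by
      calc A = A * 1 := by ring
        _ ≤ A * (1/δ * l) := by gcongr
        _ = _ := by ring
    linarith
  · linarith
  · linarith

lemma isCc_of {F : ℝ → ℝ} {a b : ℝ} (ha : 0 < a) (hb : b < π)
    (hF : ContDiffOn ℝ (⊤ : ℕ∞) F (Ioo 0 π)) (h0 : ∀ θ, θ ∉ Icc a b → F θ = 0) :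
    IsCcSmooth F := by
  have hs : tsupport F ⊆ Icc a b := by
    apply closure_minimal _ isClosed_Icc
    intro x hx
    by_contra h
    exact hx (h0 x h)
  refine ⟨?_, isCompact_Icc.of_isClosed_subset (isClosed_tsupport F) hs,
    hs.trans (Icc_sub_Ioo ha hb)⟩
  rw [contDiff_iff_contDiffAt]
  intro x
  by_cases hx : x ∈ Ioo 0 π
  · exact hF.contDiffAt (isOpen_Ioo.mem_nhds hx)
  · have hx' : x ∈ (Icc a b)ᶜ := fun h => hx (Icc_sub_Ioo ha hb h)
    have : F =ᶠ[nhds x] fun _ => 0 := by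
      filter_upwards [isClosed_Icc.isOpen_compl.mem_nhds hx'] with y hy using h0 y hy
    exact contDiffAt_const.congr_of_eventuallyEq this

lemma IsCcSmooth.exists_Icc {u : ℝ → ℝ} (hu : IsCcSmooth u) :
    ∃ a b : ℝ, 0 < a ∧ a < b ∧ b < π ∧ ∀ θ, θ ∉ Icc a b → u θ = 0 := by
  obtain ⟨h1, h2, h3⟩ := hu
  have hpi := Real.pi_gt_three
  by_cases hne : (tsupport u).Nonempty
  · obtain ⟨x, hx⟩ := IsCompact.exists_isLeast h2 hne
    obtain ⟨y, hy⟩ := IsCompact.exists_isGreatest h2 hne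
    have hx' := h3 hx.1
    have hy' := h3 hy.1
    refine ⟨x/2, (y+π)/2, by linarith [hx'.1], ?_, by linarith [hy'.2], fun θ hθ => ?_⟩
    · have := hx.2 hy.1
      linarith [hx'.1, hy'.2]
    · by_contra h
      have hmem : θ ∈ tsupport u := subset_tsupport u h
      exact hθ ⟨by linarith [hx.2 hmem, hx'.1], by linarith [hy.2 hmem, hy'.2]⟩
  · refine ⟨1, 2, by norm_num, by norm_num, by linarith, fun θ _ => ?_⟩
    by_contra h
    exact hne ⟨θ, subset_tsupport u h⟩

lemma eq_zero_nhds {u : ℝ → ℝ} {a b : ℝ} (h0 : ∀ θ, θ ∉ Icc a b → u θ = 0) {θ : ℝ}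
    (hθ : θ ∉ Icc a b) : u =ᶠ[nhds θ] fun _ => 0 := by
  filter_upwards [isClosed_Icc.isOpen_compl.mem_nhds hθ] with y hy using h0 y hy

lemma deriv_zero_out {u : ℝ → ℝ} {a b : ℝ} (h0 : ∀ θ, θ ∉ Icc a b → u θ = 0) :
    ∀ θ, θ ∉ Icc a b → deriv u θ = 0 := by
  intro θ hθ
  rw [(eq_zero_nhds h0 hθ).deriv_eq]; simp

/-- Jacobi operator -/
def jDelta (α β : ℝ) (u : ℝ → ℝ) (θ : ℝ) : ℝ := deriv (deriv u) θ + jD α β θ * deriv u θ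

lemma contDiff_deriv_top {u : ℝ → ℝ} (hu : ContDiff ℝ (⊤ : ℕ∞) u) :
    ContDiff ℝ (⊤ : ℕ∞) (deriv u) := by
  have := hu.iterate_deriv 1
  simpa using this

lemma jDelta_isCc (α β : ℝ) {u : ℝ → ℝ} (hu : IsCcSmooth u) : IsCcSmooth (jDelta α β u) := by
  obtain ⟨a, b, ha, _, hb, h0⟩ := hu.exists_Icc
  have h1 := contDiff_deriv_top hu.1
  have h2 := contDiff_deriv_top h1
  refine isCc_of ha hb ?_ ?_
  · exact h2.contDiffOn.add ((jD_contDiffOn α β).mul h1.contDiffOn)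
  · intro θ hθ
    unfold jDelta
    rw [deriv_zero_out (deriv_zero_out h0) θ hθ, deriv_zero_out h0 θ hθ]
    simp

lemma jDelta_inner {α β : ℝ} (hα : -1 < α) (hβ : -1 < β) {c : ℕ → ℝ}
    (hc : JacobiNormalized α β c) {u : ℝ → ℝ} (hu : IsCcSmooth u) (n : ℕ) :
    jacobiInner α β (jDelta α β u) (nJacobi α β c n) =
      -(jLam α β n) * jacobiInner α β u (nJacobi α β c n) := by
  obtain ⟨a, b, ha, _, hb, h0⟩ := hu.exists_Icc
  have h1 := contDiff_deriv_top hu.1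
  have hy := nJacobi_continuous α β c n
  have hDc := (jDelta_isCc α β hu).1.continuous
  unfold jacobiInner
  rw [← integral_const_mul, ← sub_eq_zero, ← integral_sub, jInt_eq]
  rotate_left
  · exact jIntegrable_of_cont hc (hDc.mul hy)
  · exact jIntegrable_of_cont hc (continuous_const.mul (hu.1.continuous.mul hy))
  set F : ℝ → ℝ := fun θ => jW α β θ * (deriv u θ * nJacobi α β c n θ - u θ * jY1 α β c n θ) with hF
  have hFz : ∀ θ, θ ∉ Icc a b → F θ = 0 := by
    intro θ hθ
    simp [hF, h0 θ hθ, deriv_zero_out h0 θ hθ]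
  have hder : ∀ θ, HasDerivAt F (jW α β θ * (jDelta α β u θ * nJacobi α β c n θ -
      -(jLam α β n) * (u θ * nJacobi α β c n θ))) θ := by
    intro θ
    by_cases h : θ ∈ Ioo 0 π
    · have d1 : HasDerivAt u (deriv u θ) θ :=
        (hu.1.differentiable (by simp) θ).hasDerivAt
      have d2 : HasDerivAt (deriv u) (deriv (deriv u) θ) θ :=
        (h1.differentiable (by simp) θ).hasDerivAt
      have := (jW_hasDerivAt α β h).mul ((d2.mul (nJacobi_hasDerivAt α β c n θ)).sub
        (d1.mul (jY1_hasDerivAt α β c n θ)))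
      refine this.congr_deriv ?_
      simp only [Pi.mul_apply, Pi.sub_apply]
      rw [jY_ode hα hβ c n h]
      unfold jDelta
      ring
    · have hθ : θ ∉ Icc a b := fun h' => h (Icc_sub_Ioo ha hb h')
      have hz := eq_zero_nhds hFz hθ
      refine HasDerivAt.congr_of_eventuallyEq ((hasDerivAt_const θ (0:ℝ)).congr_deriv ?_) hz
      unfold jDelta
      rw [deriv_zero_out (deriv_zero_out h0) θ hθ, deriv_zero_out h0 θ hθ, h0 θ hθ]
      simp
  rw [intervalIntegral.integral_eq_sub_of_hasDerivAt (fun θ _ => hder θ)]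
  · rw [hFz π (fun h => absurd h.2 (by linarith)), hFz 0 (fun h => absurd h.1 (by linarith))]
    simp
  · apply jInterval_of_cont hc
    exact (hDc.mul hy).sub (continuous_const.mul (hu.1.continuous.mul hy))

lemma jInner_bound {α β : ℝ} {c : ℕ → ℝ}
    (hc : JacobiNormalized α β c) {g : ℝ → ℝ} (hg : Continuous g) (n : ℕ) :
    |jacobiInner α β g (nJacobi α β c n)| ≤ (∫ θ, g θ ^2 ∂(jacobiMeasure α β)) + 1 := by
  unfold jacobiInner
  have hy := nJacobi_continuous α β c n
  have i1 : Integrable (fun θ => g θ ^ 2) (jacobiMeasure α β) :=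
    jIntegrable_of_cont hc (hg.pow 2)
  have i2 : Integrable (fun θ => nJacobi α β c n θ ^ 2) (jacobiMeasure α β) :=
    jIntegrable_of_cont hc (hy.pow 2)
  rw [← hc.2 n, ← integral_add i1 i2]
  refine (abs_integral_le_integral_abs).trans ?_
  refine integral_mono (jIntegrable_of_cont hc (hg.mul hy).abs)
    (jIntegrable_of_cont hc ((hg.pow 2).add (hy.pow 2))) ?_
  intro θ
  simp only [Pi.mul_apply]
  rw [abs_mul]
  nlinarith [sq_abs (g θ), sq_abs (nJacobi α β c n θ), sq_nonneg (|g θ| - |nJacobi α β c n θ|),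
    sq_nonneg (g θ), sq_nonneg (nJacobi α β c n θ)]

lemma jCoef_decay {α β : ℝ} (hα : -1 < α) (hβ : -1 < β) {c : ℕ → ℝ}
    (hc : JacobiNormalized α β c) {u : ℝ → ℝ} (hu : IsCcSmooth u) :
    ∃ G, 0 ≤ G ∧ ∀ n : ℕ, |jacobiInner α β u (nJacobi α β c (n+1))| * jLam α β (n+1) ≤
      G * (1 / ((n:ℝ)+1)^2) := by
  have hu1 := jDelta_isCc α β hu
  have hu2 := jDelta_isCc α β hu1
  obtain ⟨δ, hδ, hlow⟩ := jLam_lower hα hβ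
  set G0 := (∫ θ, (jDelta α β (jDelta α β u)) θ ^2 ∂(jacobiMeasure α β)) + 1
  have hG0 : 0 ≤ G0 := by
    have : 0 ≤ ∫ θ, (jDelta α β (jDelta α β u)) θ ^2 ∂(jacobiMeasure α β) :=
      integral_nonneg fun θ => sq_nonneg _
    simp only [G0]; linarith
  refine ⟨G0/δ, by positivity, fun n => ?_⟩
  have h1 := jInner_bound hc hu2.1.continuous (n+1)
  rw [jDelta_inner hα hβ hc hu1, jDelta_inner hα hβ hc hu] at h1
  have hl := hlow (n+1)
  set l := jLam α β (n+1)
  push_cast at hl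
  have hl0 : 0 < l := lt_of_lt_of_le (by positivity) hl
  rw [abs_mul, abs_mul, abs_neg, abs_of_pos hl0] at h1
  change _ ≤ G0 at h1
  have h2 : |jacobiInner α β u (nJacobi α β c (n+1))| * l ≤ G0 / l := by
    rw [le_div_iff₀ hl0]; linarith
  refine h2.trans ?_
  rw [div_mul_div_comm, mul_one]
  gcongr

lemma jPol_span {α β : ℝ} (hα : -1 < α) (hβ : -1 < β) {c : ℕ → ℝ}
    (hc : JacobiNormalized α β c) (p : Polynomial ℝ) :
    ∃ (N : ℕ) (d : ℕ → ℝ), ∀ M ≥ N, ∀ θ, p.eval (Real.cos θ) =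
      ∑ n ∈ Finset.range M, d n * nJacobi α β c n θ := by
  let S : Polynomial.Sequence ℝ := ⟨jPol α β, fun n => jPol_degree hα hβ n⟩
  have hS : ∀ n, S n = jPol α β n := fun n => rfl
  have hspan := S.span (fun i => by
    rw [isUnit_iff_ne_zero, Polynomial.leadingCoeff_ne_zero]; exact S.ne_zero i)
  have hp : p ∈ Submodule.span ℝ (Set.range S) := by rw [hspan]; trivial
  rw [Finsupp.mem_span_range_iff_exists_finsupp] at hp
  obtain ⟨e, he⟩ := hp
  obtain ⟨N, hN⟩ : ∃ N, e.support ⊆ Finset.range N := e.support.exists_nat_subset_range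
  refine ⟨N, fun n => e n / c n, fun M hM θ => ?_⟩
  have hM' : e.support ⊆ Finset.range M := hN.trans (Finset.range_mono hM)
  rw [← he, Finsupp.sum_of_support_subset e hM' _ (by simp), Polynomial.eval_finsetSum]
  refine Finset.sum_congr rfl fun n _ => ?_
  have := (hc.1 n).ne'
  rw [nJacobi_eq, hS]
  simp only [Polynomial.eval_smul, smul_eq_mul]
  field_simp

lemma jExpand {α β : ℝ} (hα : -1 < α) (hβ : -1 < β) {c : ℕ → ℝ}
    (hc : JacobiNormalized α β c) {u : ℝ → ℝ} (hu : Continuous u) (d : ℕ → ℝ) (M : ℕ) :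
    ∫ θ, (u θ - ∑ n ∈ Finset.range M, d n * nJacobi α β c n θ)^2 ∂(jacobiMeasure α β) =
      (∫ θ, u θ ^2 ∂(jacobiMeasure α β)) -
        ∑ n ∈ Finset.range M, (2 * d n * jacobiInner α β u (nJacobi α β c n) - d n ^ 2) := by
  have hy := nJacobi_continuous α β c
  have e : ∀ θ, (u θ - ∑ n ∈ Finset.range M, d n * nJacobi α β c n θ)^2 =
      (u θ ^ 2 - ∑ n ∈ Finset.range M, 2 * d n * (u θ * nJacobi α β c n θ)) +
      ∑ n ∈ Finset.range M, ∑ m ∈ Finset.range M, d n * d m *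
        (nJacobi α β c n θ * nJacobi α β c m θ) := by
    intro θ
    have h1 : ∑ n ∈ Finset.range M, 2 * d n * (u θ * nJacobi α β c n θ) =
        2 * u θ * ∑ n ∈ Finset.range M, d n * nJacobi α β c n θ := by
      rw [Finset.mul_sum]; exact Finset.sum_congr rfl fun _ _ => by ring
    have h2 : ∑ n ∈ Finset.range M, ∑ m ∈ Finset.range M, d n * d m *
        (nJacobi α β c n θ * nJacobi α β c m θ) =
        (∑ n ∈ Finset.range M, d n * nJacobi α β c n θ) *
        (∑ n ∈ Finset.range M, d n * nJacobi α β c n θ) := by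
      rw [Finset.sum_mul_sum]
      exact Finset.sum_congr rfl fun _ _ => Finset.sum_congr rfl fun _ _ => by ring
    rw [h1, h2]; ring
  simp only [e]
  have i1 : ∀ n, Integrable (fun θ => 2 * d n * (u θ * nJacobi α β c n θ)) (jacobiMeasure α β) :=
    fun n => jIntegrable_of_cont hc (continuous_const.mul (hu.mul (hy n)))
  have i2 : ∀ n m, Integrable (fun θ => d n * d m * (nJacobi α β c n θ * nJacobi α β c m θ))
      (jacobiMeasure α β) :=
    fun n m => jIntegrable_of_cont hc (continuous_const.mul ((hy n).mul (hy m)))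
  have i0 : Integrable (fun θ => u θ ^ 2) (jacobiMeasure α β) :=
    jIntegrable_of_cont hc (hu.pow 2)
  rw [integral_add, integral_sub i0, integral_finsetSum _ (fun n _ => i1 n),
    integral_finsetSum]
  · simp only [integral_const_mul]
    have : ∀ n ∈ Finset.range M, ∫ θ, ∑ m ∈ Finset.range M, d n * d m *
        (nJacobi α β c n θ * nJacobi α β c m θ) ∂(jacobiMeasure α β) = d n ^ 2 := by
      intro n hn
      rw [integral_finsetSum _ (fun m _ => i2 n m)]
      simp only [integral_const_mul, jOrtho hα hβ hc]
      simp only [mul_ite, mul_one, mul_zero, Finset.sum_ite_eq, hn, if_true]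
      ring
    rw [Finset.sum_congr rfl this, Finset.sum_sub_distrib]
    unfold jacobiInner
    ring
  · exact fun n _ => integrable_finsetSum _ (fun m _ => i2 n m)
  · exact integrable_finsetSum _ (fun n _ => i1 n)
  · exact i0.sub (integrable_finsetSum _ (fun n _ => i1 n))
  · exact integrable_finsetSum _ fun n _ => integrable_finsetSum _ (fun m _ => i2 n m)

lemma jL2 {α β : ℝ} (hα : -1 < α) (hβ : -1 < β) {c : ℕ → ℝ}
    (hc : JacobiNormalized α β c) {u : ℝ → ℝ} (hu : Continuous u) :
    Tendsto (fun M => ∫ θ, (u θ - ∑ n ∈ Finset.range M,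
      jacobiInner α β u (nJacobi α β c n) * nJacobi α β c n θ)^2 ∂(jacobiMeasure α β))
      atTop (nhds 0) := by
  have := jFinite hc
  rw [Metric.tendsto_atTop]
  intro ε hε
  set m := (jacobiMeasure α β).real univ
  have hm : 0 ≤ m := measureReal_nonneg
  obtain ⟨η, hη, hη2⟩ : ∃ η > 0, η^2 * m < ε := by
    refine ⟨Real.sqrt (ε / (m+1)), by positivity, ?_⟩
    rw [Real.sq_sqrt (by positivity), div_mul_eq_mul_div, div_lt_iff₀ (by positivity)]
    nlinarith
  obtain ⟨p, hp⟩ := exists_polynomial_near_of_continuousOn (-1) 1 (fun x => u (Real.arccos x))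
    (hu.comp Real.continuous_arccos).continuousOn η hη
  obtain ⟨N, d, hd⟩ := jPol_span hα hβ hc p
  refine ⟨N, fun M hM => ?_⟩
  rw [Real.dist_eq, sub_zero, abs_of_nonneg (integral_nonneg fun θ => sq_nonneg _)]
  refine lt_of_le_of_lt ?_ hη2
  have h1 := jExpand hα hβ hc hu (fun n => jacobiInner α β u (nJacobi α β c n)) M
  have h2 := jExpand hα hβ hc hu d M
  have h3 : ∫ θ, (u θ - ∑ n ∈ Finset.range M, d n * nJacobi α β c n θ)^2 ∂(jacobiMeasure α β)
      ≤ η^2 * m := by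
    simp only [← hd M hM]
    have : η^2 * m = ∫ θ, η^2 ∂(jacobiMeasure α β) := by
      rw [integral_const, smul_eq_mul, mul_comm]
    rw [this]
    refine integral_mono_ae (jIntegrable_of_cont hc (by fun_prop)) (integrable_const _) ?_
    filter_upwards [jae_Ioo α β] with θ hθ
    have := hp (Real.cos θ) ⟨Real.neg_one_le_cos θ, Real.cos_le_one θ⟩
    rw [Real.arccos_cos hθ.1.le hθ.2.le, abs_sub_comm] at this
    exact sq_le_sq' (by linarith [(abs_lt.1 this).1]) (abs_lt.1 this).2.le
  refine le_trans ?_ h3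
  rw [h1, h2]
  apply sub_le_sub_left
  apply Finset.sum_le_sum
  intro n _
  nlinarith [sq_nonneg (d n - jacobiInner α β u (nJacobi α β c n))]

lemma jSeries {α β : ℝ} (hα : -1 < α) (hβ : -1 < β) {c : ℕ → ℝ}
    (hc : JacobiNormalized α β c) {u : ℝ → ℝ} (hu : IsCcSmooth u) {a b : ℝ} (ha : 0 < a)
    (hab : a < b) (hb : b < π) {θ : ℝ} (hθ : θ ∈ Ioo a b) :
    HasSum (fun n => jacobiInner α β u (nJacobi α β c (n+1)) * jY2 α β c (n+1) θ)
      (deriv (deriv u) θ) := by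
  set A : ℕ → ℝ := fun n => jacobiInner α β u (nJacobi α β c n) with hA
  obtain ⟨K, hK0, hK⟩ := jY_bounds hα hβ hc ha hab hb
  obtain ⟨G, hG0, hG⟩ := jCoef_decay hα hβ hc hu
  have hsub := Icc_sub_Ioo ha hb
  set B : ℕ → ℝ := fun n => K * (G * (1 / ((n:ℝ)+1)^2)) with hB
  have hBs : Summable B := by
    have h1 : Summable (fun n : ℕ => 1 / ((n:ℝ))^2) := Real.summable_one_div_nat_pow.2 (by norm_num)
    have h2 := (summable_nat_add_iff 1).2 h1
    simp only [Nat.cast_add, Nat.cast_one] at h2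
    exact (h2.mul_left G).mul_left K
  have bd : ∀ (n : ℕ) (z : ℝ), |z| ≤ K * jLam α β (n+1) → |A (n+1) * z| ≤ B n := by
    intro n z hz
    rw [abs_mul]
    have h1 := hG n
    calc |A (n+1)| * |z| ≤ |A (n+1)| * (K * jLam α β (n+1)) := by gcongr
      _ = K * (|A (n+1)| * jLam α β (n+1)) := by ring
      _ ≤ B n := by simp only [hB]; gcongr
  have b0 : ∀ n : ℕ, ∀ x ∈ Ioo a b, ‖A (n+1) * nJacobi α β c (n+1) x‖ ≤ B n :=
    fun n x hx => bd n _ (hK n x (Ioo_subset_Icc_self hx)).1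
  have b1 : ∀ n : ℕ, ∀ x ∈ Ioo a b, ‖A (n+1) * jY1 α β c (n+1) x‖ ≤ B n :=
    fun n x hx => bd n _ (hK n x (Ioo_subset_Icc_self hx)).2.1
  have b2 : ∀ n : ℕ, ∀ x ∈ Ioo a b, ‖A (n+1) * jY2 α β c (n+1) x‖ ≤ B n :=
    fun n x hx => bd n _ (hK n x (Ioo_subset_Icc_self hx)).2.2
  set h : ℝ → ℝ := fun x => ∑' n, A (n+1) * nJacobi α β c (n+1) x
  set h1 : ℝ → ℝ := fun x => ∑' n, A (n+1) * jY1 α β c (n+1) x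
  set h2 : ℝ → ℝ := fun x => ∑' n, A (n+1) * jY2 α β c (n+1) x
  have d0 : ∀ x ∈ Ioo a b, HasDerivAt h (h1 x) x := fun x hx =>
    hasDerivAt_tsum_of_isPreconnected hBs isOpen_Ioo isPreconnected_Ioo
      (fun n y _ => (nJacobi_hasDerivAt α β c (n+1) y).const_mul (A (n+1))) b1 hx
      (Summable.of_norm_bounded hBs fun n => b0 n x hx) hx
  have d1 : ∀ x ∈ Ioo a b, HasDerivAt h1 (h2 x) x := fun x hx =>
    hasDerivAt_tsum_of_isPreconnected hBs isOpen_Ioo isPreconnected_Ioo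
      (fun n y _ => (jY1_hasDerivAt α β c (n+1) y).const_mul (A (n+1))) b2 hx
      (Summable.of_norm_bounded hBs fun n => b1 n x hx) hx
  -- the zero-th term is constant
  obtain ⟨k0, hk0⟩ : ∃ k0, ∀ x, A 0 * nJacobi α β c 0 x = k0 :=
    ⟨A 0 * nJacobi α β c 0 0, fun x => by simp [nJacobi, jacobiPoly]⟩
  -- partial sums
  set S : ℕ → ℝ → ℝ := fun M x => ∑ n ∈ Finset.range M, A n * nJacobi α β c n x with hS
  have hSc : ∀ M, Continuous (S M) := fun M =>
    continuous_finsetSum _ fun n _ => continuous_const.mul (nJacobi_continuous α β c n)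
  have hSlim : ∀ x ∈ Ioo a b, Tendsto (fun M => S (M+1) x) atTop (nhds (h x + k0)) := by
    intro x hx
    have hs : Summable (fun n => A (n+1) * nJacobi α β c (n+1) x) :=
      Summable.of_norm_bounded hBs fun n => b0 n x hx
    have := (hs.hasSum.tendsto_sum_nat).add_const k0
    refine this.congr fun M => ?_
    simp only [hS]
    rw [Finset.sum_range_succ', hk0 x]
  have hSb : ∀ M, ∀ x ∈ Ioo a b, |S (M+1) x| ≤ (∑' n, B n) + |k0| := by
    intro M x hx
    simp only [hS]
    rw [Finset.sum_range_succ', hk0 x]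
    refine (abs_add_le _ _).trans ?_
    gcongr
    refine (Finset.abs_sum_le_sum_abs _ _).trans ?_
    refine (Finset.sum_le_sum fun n _ => b0 n x hx).trans ?_
    exact hBs.sum_le_tsum _ (fun n _ => by positivity)
  obtain ⟨U, hU⟩ := (isCompact_Icc (a := a) (b := b)).exists_bound_of_continuousOn
    hu.1.continuous.continuousOn
  obtain ⟨V, hV⟩ := (isCompact_Icc (a := a) (b := b)).exists_bound_of_continuousOn
    ((jW_continuousOn α β).mono hsub)
  have hsub' : Ioo a b ⊆ Ioo 0 π := Ioo_subset_Icc_self.trans hsub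
  have hlim1 : Tendsto (fun M => ∫ x in Ioo a b, jW α β x * (u x - S (M+1) x)^2) atTop
      (nhds (∫ x in Ioo a b, jW α β x * (u x - (h x + k0))^2)) := by
    refine tendsto_integral_of_dominated_convergence
      (fun _ => V * (U + ((∑' n, B n) + |k0|))^2) ?_ ?_ ?_ ?_
    · intro M
      exact ((jW_measurable α β).mul
        ((hu.1.continuous.sub (hSc (M+1))).pow 2).measurable).aestronglyMeasurable
    · exact integrableOn_const (by simp)
    · intro M
      filter_upwards [ae_restrict_mem measurableSet_Ioo] with x hx
      have e1 := hV x (Ioo_subset_Icc_self hx)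
      have e2 := hU x (Ioo_subset_Icc_self hx)
      have e3 := hSb M x hx
      rw [norm_mul, norm_pow, Real.norm_eq_abs (u x - S (M+1) x)]
      have e4 : |u x - S (M+1) x| ≤ U + ((∑' n, B n) + |k0|) := (abs_sub _ _).trans (by
        rw [Real.norm_eq_abs] at e2; linarith)
      have e5 : 0 ≤ V := (norm_nonneg _).trans e1
      gcongr
    · filter_upwards [ae_restrict_mem measurableSet_Ioo] with x hx
      exact ((tendsto_const_nhds.sub (hSlim x hx)).pow 2).const_mul _
  have hlim2 : Tendsto (fun M => ∫ x in Ioo a b, jW α β x * (u x - S (M+1) x)^2) atTop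
      (nhds 0) := by
    have := (tendsto_add_atTop_iff_nat 1).2 (jL2 hα hβ hc hu.1.continuous)
    refine squeeze_zero (fun M => ?_) (fun M => ?_) this
    · exact setIntegral_nonneg measurableSet_Ioo fun x hx =>
        mul_nonneg (jW_pos α β (hsub' hx)).le (sq_nonneg _)
    · rw [jInt_eq']
      refine setIntegral_mono_set ?_ ?_ hsub'.eventuallyLE
      · refine (jIntegrable_iff α β _).1 (jIntegrable_of_cont hc ?_)
        exact (hu.1.continuous.sub (hSc (M+1))).pow 2
      · filter_upwards [ae_restrict_mem measurableSet_Ioo] with x hx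
        exact mul_nonneg (jW_pos α β hx).le (sq_nonneg _)
  have hzero := tendsto_nhds_unique hlim1 hlim2
  have hhc : ContinuousOn h (Ioo a b) := fun x hx => (d0 x hx).continuousAt.continuousWithinAt
  have hae : (u) =ᵐ[volume.restrict (Ioo a b)] (fun x => h x + k0) := by
    rw [integral_eq_zero_iff_of_nonneg_ae] at hzero
    · filter_upwards [hzero, ae_restrict_mem measurableSet_Ioo] with x hx hm
      have e1 := (jW_pos α β (hsub' hm)).ne'
      simp only [Pi.zero_apply, mul_eq_zero, e1, false_or] at hx
      have := pow_eq_zero_iff (two_ne_zero) |>.1 hx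
      linarith
    · filter_upwards [ae_restrict_mem measurableSet_Ioo] with x hx
      exact mul_nonneg (jW_pos α β (hsub' hx)).le (sq_nonneg _)
    · have hc1 : ContinuousOn (fun x => jW α β x * (u x - (h x + k0))^2) (Ioo a b) :=
        ((jW_continuousOn α β).mono hsub').mul
          ((hu.1.continuous.continuousOn.sub (hhc.add continuousOn_const)).pow 2)
      refine Integrable.of_bound (hc1.aestronglyMeasurable measurableSet_Ioo)
        (V * (U + ((∑' n, B n) + |k0|))^2) ?_
      filter_upwards [ae_restrict_mem measurableSet_Ioo] with x hx
      have e1 := hV x (Ioo_subset_Icc_self hx)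
      have e2 := hU x (Ioo_subset_Icc_self hx)
      have e3 : |h x + k0| ≤ (∑' n, B n) + |k0| :=
        le_of_tendsto (hSlim x hx).abs (Eventually.of_forall fun M => hSb M x hx)
      rw [norm_mul, norm_pow, Real.norm_eq_abs (u x - (h x + k0))]
      have e4 : |u x - (h x + k0)| ≤ U + ((∑' n, B n) + |k0|) := (abs_sub _ _).trans (by
        rw [Real.norm_eq_abs] at e2; linarith)
      have e5 : 0 ≤ V := (norm_nonneg _).trans e1
      gcongr
  have heq := Measure.eqOn_open_of_ae_eq hae isOpen_Ioo hu.1.continuous.continuousOn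
    (hhc.add continuousOn_const)
  have hdu : ∀ x ∈ Ioo a b, deriv u x = h1 x := by
    intro x hx
    have : u =ᶠ[nhds x] (fun x => h x + k0) := by
      filter_upwards [isOpen_Ioo.mem_nhds hx] with y hy using heq hy
    rw [this.deriv_eq]
    exact ((d0 x hx).add_const k0).deriv
  have hddu : deriv (deriv u) θ = h2 θ := by
    have : deriv u =ᶠ[nhds θ] h1 := by
      filter_upwards [isOpen_Ioo.mem_nhds hθ] with y hy using hdu y hy
    rw [this.deriv_eq]
    exact (d1 θ hθ).deriv
  rw [hddu]
  exact (Summable.of_norm_bounded hBs fun n => b2 n θ hθ).hasSum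

lemma jRiesz {α β : ℝ} (hα : -1 < α) (hβ : -1 < β) {c : ℕ → ℝ}
    (hc : JacobiNormalized α β c) {u : ℝ → ℝ} (hu : IsCcSmooth u) {θ : ℝ} (hθ : θ ∈ Ioo 0 π) :
    rieszTransform α β c 2 (fun x => jacobiTau α β ^ 2 * u x - jDelta α β u x) θ =
      deriv (deriv u) θ := by
  obtain ⟨h0, h1⟩ := hθ
  have := jSeries hα hβ hc hu (a := θ/2) (b := (θ+π)/2) (by linarith) (by linarith)
    (by linarith) (θ := θ) ⟨by linarith, by linarith⟩
  rw [← this.tsum_eq]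
  unfold rieszTransform
  congr 1
  funext n
  rw [nJacobi_iteratedDeriv]
  congr 1
  have hy := nJacobi_continuous α β c (n+1)
  have e1 : jacobiInner α β (fun x => jacobiTau α β ^ 2 * u x - jDelta α β u x)
      (nJacobi α β c (n+1)) = ((n:ℝ)+1+jacobiTau α β)^2 *
        jacobiInner α β u (nJacobi α β c (n+1)) := by
    have e2 := jDelta_inner hα hβ hc hu (n+1)
    have e3 : jacobiInner α β (fun x => jacobiTau α β ^ 2 * u x - jDelta α β u x)
      (nJacobi α β c (n+1)) = jacobiTau α β ^ 2 * jacobiInner α β u (nJacobi α β c (n+1)) -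
        jacobiInner α β (jDelta α β u) (nJacobi α β c (n+1)) := by
      unfold jacobiInner
      rw [← integral_const_mul, ← integral_sub]
      · congr 1; funext x; ring
      · exact jIntegrable_of_cont hc (continuous_const.mul (hu.1.continuous.mul hy))
      · exact jIntegrable_of_cont hc ((jDelta_isCc α β hu).1.continuous.mul hy)
    rw [e3, e2]
    unfold jLam jacobiTau
    push_cast
    ring
  rw [e1, Real.rpow_neg (abs_nonneg _), Real.rpow_natCast, sq_abs]
  have : (n:ℝ)+1+jacobiTau α β ≠ 0 := by
    have : (0:ℝ) ≤ n := by positivity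
    unfold jacobiTau; linarith
  field_simp

/-- The reduced inequality. -/
def JIneq (α β : ℝ) : Prop := ∃ C : ℝ, 0 ≤ C ∧ ∀ u : ℝ → ℝ, IsCcSmooth u →
  ∫ θ in (0:ℝ)..π, jW α β θ * |deriv (deriv u) θ| ≤
    C * ∫ θ in (0:ℝ)..π, jW α β θ * |jacobiTau α β ^ 2 * u θ - jDelta α β u θ|

lemma jReduce {α β : ℝ} (hα : -1 < α) (hβ : -1 < β) {c : ℕ → ℝ}
    (hc : JacobiNormalized α β c)
    (H : ∃ C : ℝ, ∀ f : ℝ → ℝ, IsCcSmooth f →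
      ∫ θ, |rieszTransform α β c 2 f θ| ∂(jacobiMeasure α β) ≤
        C * ∫ θ, |f θ| ∂(jacobiMeasure α β)) : JIneq α β := by
  obtain ⟨C, hC⟩ := H
  refine ⟨|C|, abs_nonneg C, fun u hu => ?_⟩
  have hf : IsCcSmooth (fun x => jacobiTau α β ^ 2 * u x - jDelta α β u x) := by
    obtain ⟨a, b, ha, _, hb, h0⟩ := hu.exists_Icc
    refine isCc_of ha hb ?_ ?_
    · exact (contDiffOn_const.mul hu.1.contDiffOn).sub (jDelta_isCc α β hu).1.contDiffOn
    · intro θ hθ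
      unfold jDelta
      rw [deriv_zero_out (deriv_zero_out h0) θ hθ, deriv_zero_out h0 θ hθ, h0 θ hθ]
      simp
  have h1 := hC _ hf
  have h2 : ∫ θ, |rieszTransform α β c 2
      (fun x => jacobiTau α β ^ 2 * u x - jDelta α β u x) θ| ∂(jacobiMeasure α β) =
      ∫ θ, |deriv (deriv u) θ| ∂(jacobiMeasure α β) := by
    apply integral_congr_ae
    filter_upwards [jae_Ioo α β] with θ hθ
    rw [jRiesz hα hβ hc hu hθ]
  rw [h2, jInt_eq] at h1
  rw [← jInt_eq α β (fun θ => |jacobiTau α β ^ 2 * u θ - jDelta α β u θ|)]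
  refine h1.trans ?_
  have : 0 ≤ ∫ θ, |jacobiTau α β ^ 2 * u θ - jDelta α β u θ| ∂(jacobiMeasure α β) :=
    integral_nonneg fun θ => abs_nonneg _
  gcongr
  exact le_abs_self C

lemma JIneq.symm {α β : ℝ} (h : JIneq α β) : JIneq β α := by
  obtain ⟨C, hC0, hC⟩ := h
  refine ⟨C, hC0, fun u hu => ?_⟩
  have hpi := Real.pi_pos
  set v : ℝ → ℝ := fun θ => u (π - θ) with hv
  have hvcc : IsCcSmooth v := by
    obtain ⟨a, b, ha, _, hb, h0⟩ := hu.exists_Icc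
    refine isCc_of (a := π - b) (b := π - a) (by linarith) (by linarith) ?_ ?_
    · exact (hu.1.comp (contDiff_const.sub contDiff_id)).contDiffOn
    · intro θ hθ
      apply h0
      intro h
      exact hθ ⟨by linarith [h.2], by linarith [h.1]⟩
  have e1 : deriv v = fun θ => - deriv u (π - θ) := by
    funext θ; exact deriv_comp_const_sub u π θ
  have e2 : deriv (deriv v) = fun θ => deriv (deriv u) (π - θ) := by
    rw [e1]
    funext θ
    have h1 : deriv (fun θ => -deriv u (π - θ)) θ = -deriv (fun θ => deriv u (π - θ)) θ :=
      deriv.fun_neg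
    rw [h1, deriv_comp_const_sub (deriv u) π θ, neg_neg]
  have eW : ∀ θ, jW α β (π - θ) = jW β α θ := by
    intro θ
    unfold jW
    rw [show (π - θ)/2 = π/2 - θ/2 by ring, Real.sin_pi_div_two_sub, Real.cos_pi_div_two_sub,
      mul_comm]
  have eD : ∀ θ, jD α β (π - θ) = - jD β α θ := by
    intro θ
    unfold jD
    rw [Real.sin_pi_sub, Real.cos_pi_sub]
    ring
  have eT : jacobiTau α β = jacobiTau β α := by unfold jacobiTau; ring
  have h1 := hC v hvcc
  have i1 := intervalIntegral.integral_comp_sub_left (a := 0) (b := π)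
    (fun θ => jW α β θ * |deriv (deriv v) θ|) π
  have i2 := intervalIntegral.integral_comp_sub_left (a := 0) (b := π)
    (fun θ => jW α β θ * |jacobiTau α β ^ 2 * v θ - jDelta α β v θ|) π
  simp only [sub_self, sub_zero] at i1 i2
  rw [← i1, ← i2] at h1
  unfold jDelta at h1 ⊢
  simp only [e2] at h1
  simp only [e1] at h1
  simp only [eW, eD, hv, eT, sub_sub_cancel, neg_mul_neg] at h1
  exact h1

lemma jW_compare (α β : ℝ) : ∃ w0 w1 : ℝ, 0 < w0 ∧ 0 < w1 ∧ ∀ θ ∈ Ioc (0:ℝ) 1,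
    w0 * θ ^ (2*α+1) ≤ jW α β θ ∧ jW α β θ ≤ w1 * θ ^ (2*α+1) := by
  set g : ℝ → ℝ := fun θ => (Real.sinc (θ/2) / 2) ^ (2*α+1) * Real.cos (θ/2) ^ (2*β+1) with hg
  have hpi := Real.pi_gt_three
  have hsinc : ∀ θ ∈ Icc (0:ℝ) 1, 0 < Real.sinc (θ/2) := by
    intro θ hθ
    rcases hθ.1.eq_or_lt with h | h
    · rw [← h]; simp
    · rw [Real.sinc_of_ne_zero (by positivity)]
      have := sin_half_pos (θ := θ) ⟨h, by linarith [hθ.2]⟩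
      positivity
  have hcos : ∀ θ ∈ Icc (0:ℝ) 1, 0 < Real.cos (θ/2) := fun θ hθ =>
    Real.cos_pos_of_mem_Ioo ⟨by linarith [hθ.1], by linarith [hθ.2]⟩
  have hc : ContinuousOn g (Icc 0 1) := by
    apply ContinuousOn.mul
    · apply ContinuousOn.rpow_const
      · exact ((Real.continuous_sinc.comp (continuous_id.div_const 2)).div_const 2).continuousOn
      · exact fun θ hθ => Or.inl (by have := hsinc θ hθ; positivity)
    · apply ContinuousOn.rpow_const
      · exact (Real.continuous_cos.comp (continuous_id.div_const 2)).continuousOn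
      · exact fun θ hθ => Or.inl (hcos θ hθ).ne'
  have hgpos : ∀ θ ∈ Icc (0:ℝ) 1, 0 < g θ := fun θ hθ =>
    mul_pos (Real.rpow_pos_of_pos (by have := hsinc θ hθ; positivity) _)
      (Real.rpow_pos_of_pos (hcos θ hθ) _)
  obtain ⟨x0, hx0, hmin⟩ := (isCompact_Icc (a := (0:ℝ)) (b := 1)).exists_isMinOn
    (nonempty_Icc.2 zero_le_one) hc
  obtain ⟨x1, hx1, hmax⟩ := (isCompact_Icc (a := (0:ℝ)) (b := 1)).exists_isMaxOn
    (nonempty_Icc.2 zero_le_one) hc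
  refine ⟨g x0, g x1, hgpos _ hx0, hgpos _ hx1, fun θ hθ => ?_⟩
  have hθ' : θ ∈ Icc (0:ℝ) 1 := ⟨hθ.1.le, hθ.2⟩
  have hp : 0 < θ ^ (2*α+1) := Real.rpow_pos_of_pos hθ.1 _
  have e : jW α β θ = g θ * θ ^ (2*α+1) := by
    simp only [hg]
    unfold jW
    have h1 : Real.sin (θ/2) = (Real.sinc (θ/2) / 2) * θ := by
      rw [Real.sinc_of_ne_zero (by have := hθ.1; positivity)]
      have := hθ.1.ne'
      field_simp
    rw [h1, Real.mul_rpow (by have := hsinc θ hθ'; positivity) hθ.1.le]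
    ring
  rw [e]
  constructor
  · gcongr; exact hmin hθ'
  · gcongr; exact hmax hθ'

lemma jD_compare (α β : ℝ) : ∃ K : ℝ, 0 ≤ K ∧ ∀ θ ∈ Ioc (0:ℝ) 1,
    |θ * jD α β θ - (2*α+1)| ≤ K * θ := by
  refine ⟨2*(|α+β+1| + |2*α+1|), by positivity, fun θ hθ => ?_⟩
  obtain ⟨h0, h1⟩ := hθ
  have hs : θ - θ^3/6 < Real.sin θ := Real.sin_gt_sub_cube h0
  have hs2 : Real.sin θ ≤ θ := Real.sin_le h0.le
  have hc := Real.one_sub_sq_div_two_le_cos (x := θ)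
  have hc2 := Real.cos_le_one θ
  have hsl : θ/2 ≤ Real.sin θ := by
    have : θ^3 ≤ θ := by
      have : θ^2 ≤ 1 := by nlinarith
      nlinarith
    linarith
  have hsp : 0 < Real.sin θ := by linarith
  have e : θ * jD α β θ - (2*α+1) = ((2*α+1) * (θ - Real.sin θ) -
      (α+β+1) * (θ * (1 - Real.cos θ))) / Real.sin θ := by
    unfold jD; field_simp; ring
  rw [e, abs_div, abs_of_pos hsp, div_le_iff₀ hsp]
  have b1 : |θ - Real.sin θ| ≤ θ^2 := by
    rw [abs_of_nonneg (by linarith)]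
    nlinarith [sq_nonneg θ]
  have b2 : |θ * (1 - Real.cos θ)| ≤ θ^2 := by
    rw [abs_of_nonneg (mul_nonneg h0.le (by linarith))]
    nlinarith [sq_nonneg θ]
  calc _ ≤ |2*α+1| * |θ - Real.sin θ| + |α+β+1| * |θ * (1 - Real.cos θ)| := by
        refine (abs_sub _ _).trans ?_
        rw [abs_mul, abs_mul]
    _ ≤ |2*α+1| * θ^2 + |α+β+1| * θ^2 := by gcongr
    _ = 2*(|α+β+1| + |2*α+1|) * θ * (θ/2) := by ring
    _ ≤ _ := by gcongr

lemma log_sub (M : ℝ) (hM : 0 < M) (g : ℝ → ℝ) (hg : Continuous g) :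
    ∫ θ in Real.exp (-(2*M))..Real.exp (-M), g (Real.log θ / M) * (1/(M*θ)) =
      ∫ x in (-2:ℝ)..(-1), g x := by
  have hle : Real.exp (-(2*M)) ≤ Real.exp (-M) := Real.exp_le_exp.2 (by linarith)
  have hpos : ∀ x ∈ uIcc (Real.exp (-(2*M))) (Real.exp (-M)), 0 < x := by
    intro x hx
    rw [uIcc_of_le hle] at hx
    exact (Real.exp_pos _).trans_le hx.1
  have := intervalIntegral.integral_comp_mul_deriv (a := Real.exp (-(2*M))) (b := Real.exp (-M))
    (f := fun θ => Real.log θ / M) (f' := fun θ => 1/(M*θ)) (g := g) ?_ ?_ hg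
  · simp only [Function.comp_def, Real.log_exp] at this
    rw [this]
    congr 1 <;> field_simp
  · intro x hx
    have hx0 := (hpos x hx).ne'
    refine ((Real.hasDerivAt_log hx0).div_const M).congr_deriv ?_
    field_simp
  · apply ContinuousOn.div continuousOn_const (by fun_prop)
    intro x hx
    have := hpos x hx
    positivity

lemma pow_log_deriv (p M : ℝ) {g g' : ℝ → ℝ} (hg : ∀ x, HasDerivAt g (g' x) x) {θ : ℝ}
    (hθ : 0 < θ) : HasDerivAt (fun θ => θ ^ p * g (Real.log θ / M))
      (θ ^ (p-1) * (p * g (Real.log θ / M) + g' (Real.log θ / M) / M)) θ := by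
  have h1 := Real.hasDerivAt_rpow_const (x := θ) (p := p) (Or.inl hθ.ne')
  have h2 := (hg (Real.log θ / M)).comp θ ((Real.hasDerivAt_log hθ.ne').div_const M)
  refine (h1.mul h2).congr_deriv ?_
  simp only [Function.comp]
  rw [Real.rpow_sub_one hθ.ne']
  field_simp

lemma restrict_integral {F : ℝ → ℝ} {a b : ℝ} (ha : 0 < a) (hab : a ≤ b) (hb : b < π)
    (h0 : ∀ θ, θ ∉ Icc a b → F θ = 0) : ∫ θ in (0:ℝ)..π, F θ = ∫ θ in a..b, F θ := by
  rw [intervalIntegral.integral_of_le Real.pi_pos.le, intervalIntegral.integral_of_le hab,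
    ← integral_Icc_eq_integral_Ioc, ← integral_Icc_eq_integral_Ioc]
  refine (setIntegral_eq_of_subset_of_forall_sdiff_eq_zero measurableSet_Icc ?_ ?_)
  · exact Icc_subset_Icc ha.le hb.le
  · exact fun x hx => h0 x hx.2

lemma jCore {α β : ℝ} (hα : α ≠ -1/2) (H : JIneq α β) {k k1 k2 : ℝ → ℝ}
    (hk : ContDiff ℝ (⊤ : ℕ∞) k) (hk0 : ∀ x, x ∉ Icc (-2:ℝ) (-1) → k x = 0)
    (d1 : ∀ x, HasDerivAt k (k1 x) x) (d2 : ∀ x, HasDerivAt k1 (k2 x) x)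
    (c2 : Continuous k2) :
    ∃ E : ℝ, ∀ M : ℝ, 1 ≤ M → ∫ x in (-2:ℝ)..(-1), |-2*α*k x + k1 x / M| ≤
      E * (|α| / M + 1/M^2) := by
  obtain ⟨C, hC0, hC⟩ := H
  obtain ⟨w0, w1, hw0, hw1, hW⟩ := jW_compare α β
  obtain ⟨K, hK0, hK⟩ := jD_compare α β
  have c0 : Continuous k := hk.continuous
  have c1 : Continuous k1 := continuous_iff_continuousAt.2 fun x => (d2 x).continuousAt
  obtain ⟨B, hB1, hB⟩ : ∃ B : ℝ, 0 ≤ B ∧ ∀ x ∈ Icc (-2:ℝ) (-1), |k x| ≤ B ∧ |k1 x| ≤ B ∧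
      |k2 x| ≤ B := by
    obtain ⟨B0, h0⟩ := (isCompact_Icc (a := (-2:ℝ)) (b := -1)).exists_bound_of_continuousOn
      c0.continuousOn
    obtain ⟨B1, h1⟩ := (isCompact_Icc (a := (-2:ℝ)) (b := -1)).exists_bound_of_continuousOn
      c1.continuousOn
    obtain ⟨B2, h2⟩ := (isCompact_Icc (a := (-2:ℝ)) (b := -1)).exists_bound_of_continuousOn
      c2.continuousOn
    refine ⟨|B0|+|B1|+|B2|, by positivity, fun x hx => ?_⟩
    have e0 := h0 x hx
    have e1 := h1 x hx
    have e2 := h2 x hx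
    rw [Real.norm_eq_abs] at e0 e1 e2
    have f0 := le_abs_self B0
    have f1 := le_abs_self B1
    have f2 := le_abs_self B2
    have g0 := abs_nonneg B0
    have g1 := abs_nonneg B1
    have g2 := abs_nonneg B2
    exact ⟨by linarith, by linarith, by linarith⟩
  set T := jacobiTau α β ^ 2 with hT
  have hT0 : 0 ≤ T := sq_nonneg _
  have hA : 0 < |2*α+1| := abs_pos.2 fun h => hα (by linarith)
  set E2 := 2*B + B + 2*(K*(2*|α| * B+B) + T*B) with hE2
  refine ⟨(C * w1 / w0 + 1) * E2 / |2*α+1|, fun M hM => ?_⟩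
  have hM0 : 0 < M := by linarith
  set V : ℝ → ℝ := fun x => -2*α*k x + k1 x / M with hV
  set V' : ℝ → ℝ := fun x => -2*α*k1 x + k2 x / M with hV'
  have dV : ∀ x, HasDerivAt V (V' x) x := fun x =>
    ((d1 x).const_mul (-2*α)).add ((d2 x).div_const M)
  have cV : Continuous V := (continuous_const.mul c0).add (c1.div_const M)
  have cV' : Continuous V' := (continuous_const.mul c1).add (c2.div_const M)
  set a := Real.exp (-(2*M)) with ha_def
  set b := Real.exp (-M) with hb_def
  have ha : 0 < a := Real.exp_pos _
  have hab : a ≤ b := Real.exp_le_exp.2 (by linarith)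
  have hb1 : b ≤ 1 := Real.exp_le_one_iff.2 (by linarith)
  have hbpi : b < π := by linarith [Real.pi_gt_three]
  have hsub := Icc_sub_Ioo ha hbpi
  have hbM : b ≤ 2/M^2 := by
    have := Real.quadratic_le_exp_of_nonneg hM0.le
    rw [hb_def, Real.exp_neg, inv_eq_one_div, div_le_div_iff₀ (Real.exp_pos _) (by positivity)]
    linarith
  set u : ℝ → ℝ := fun θ => if 0 < θ then θ ^ (-2*α) * k (Real.log θ / M) else 0 with hu_def
  have hu_pos : ∀ θ, 0 < θ → u θ = θ ^ (-2*α) * k (Real.log θ / M) := by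
    intro θ h; simp [hu_def, h]
  have hlogmem : ∀ θ, 0 < θ → (Real.log θ / M ∈ Icc (-2:ℝ) (-1) ↔ θ ∈ Icc a b) := by
    intro θ h
    simp only [mem_Icc, le_div_iff₀ hM0, div_le_iff₀ hM0, ha_def, hb_def]
    rw [Real.le_log_iff_exp_le h, Real.log_le_iff_le_exp h]
    simp
  have hu0 : ∀ θ, θ ∉ Icc a b → u θ = 0 := by
    intro θ hθ
    by_cases h : 0 < θ
    · rw [hu_pos θ h, hk0 _ (fun h' => hθ ((hlogmem θ h).1 h')), mul_zero]
    · simp [hu_def, h]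
  have hucc : IsCcSmooth u := by
    refine isCc_of ha hbpi ?_ hu0
    have : ContDiffOn ℝ (⊤ : ℕ∞) (fun θ => θ ^ (-2*α) * k (Real.log θ / M)) (Ioo 0 π) := by
      intro θ hθ
      have hθ0 : θ ≠ 0 := hθ.1.ne'
      apply ContDiffAt.contDiffWithinAt
      exact (Real.contDiffAt_rpow_const_of_ne hθ0).mul
        (hk.contDiffAt.comp θ ((Real.contDiffAt_log.2 hθ0).div_const M))
    exact this.congr fun θ hθ => hu_pos θ hθ.1
  have du : ∀ θ, 0 < θ → deriv u θ = θ ^ (-2*α-1) * V (Real.log θ / M) := by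
    intro θ h
    have : u =ᶠ[nhds θ] fun θ => θ ^ (-2*α) * k (Real.log θ / M) := by
      filter_upwards [isOpen_Ioi.mem_nhds h] with y hy using hu_pos y hy
    rw [this.deriv_eq, (pow_log_deriv (-2*α) M d1 h).deriv]
  have ddu : ∀ θ, 0 < θ → deriv (deriv u) θ = θ ^ (-2*α-1-1) *
      ((-2*α-1) * V (Real.log θ / M) + V' (Real.log θ / M) / M) := by
    intro θ h
    have : deriv u =ᶠ[nhds θ] fun θ => θ ^ (-2*α-1) * V (Real.log θ / M) := by
      filter_upwards [isOpen_Ioi.mem_nhds h] with y hy using du y hy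
    rw [this.deriv_eq, (pow_log_deriv (-2*α-1) M dV h).deriv]
  have hpw : ∀ θ : ℝ, 0 < θ → θ ^ (2*α+1) * θ ^ (-2*α-1-1) = 1/θ := by
    intro θ h
    rw [← Real.rpow_add h, show 2*α+1 + (-2*α-1-1) = -1 by ring, Real.rpow_neg_one, one_div]
  have hmain := hC u hucc
  have hudd0 := deriv_zero_out (deriv_zero_out hu0)
  have hud0 := deriv_zero_out hu0
  have hDcc := jDelta_isCc α β hucc
  have hDz : ∀ θ, θ ∉ Icc a b → jDelta α β u θ = 0 := by
    intro θ hθ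
    unfold jDelta
    rw [hudd0 θ hθ, hud0 θ hθ]; simp
  rw [restrict_integral ha hab hbpi (fun θ hθ => by rw [hudd0 θ hθ]; simp),
    restrict_integral ha hab hbpi (fun θ hθ => by rw [hDz θ hθ, hu0 θ hθ]; simp)] at hmain
  have hWc : ContinuousOn (jW α β) (Icc a b) := (jW_continuousOn α β).mono hsub
  have hddc : Continuous (deriv (deriv u)) :=
    (contDiff_deriv_top (contDiff_deriv_top hucc.1)).continuous
  have hlogc : ContinuousOn (fun θ => Real.log θ / M) (Icc a b) := by
    apply ContinuousOn.div_const
    exact Real.continuousOn_log.mono fun x hx => (ha.trans_le hx.1).ne'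
  have hinvc : ContinuousOn (fun θ => 1/(M*θ)) (Icc a b) := by
    apply ContinuousOn.div continuousOn_const (by fun_prop)
    intro x hx
    have := ha.trans_le hx.1
    positivity
  -- lower bound
  set g1 : ℝ → ℝ := fun x => M * w0 * |(-2*α-1) * V x + V' x / M| with hg1
  have cg1 : Continuous g1 :=
    continuous_const.mul ((continuous_const.mul cV).add (cV'.div_const M)).abs
  have low : ∫ x in (-2:ℝ)..(-1), g1 x ≤ ∫ θ in a..b, jW α β θ * |deriv (deriv u) θ| := by
    rw [← log_sub M hM0 g1 cg1]
    refine intervalIntegral.integral_mono_on hab ?_ ?_ ?_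
    · apply ContinuousOn.intervalIntegrable_of_Icc hab
      exact (cg1.comp_continuousOn hlogc).mul hinvc
    · apply ContinuousOn.intervalIntegrable_of_Icc hab
      exact hWc.mul hddc.abs.continuousOn
    · intro θ hθ
      have h0 : 0 < θ := ha.trans_le hθ.1
      have h1 := (hW θ ⟨h0, hθ.2.trans hb1⟩).1
      rw [ddu θ h0, abs_mul, abs_of_pos (Real.rpow_pos_of_pos h0 _)]
      simp only [hg1]
      set Z := |(-2*α-1) * V (Real.log θ / M) + V' (Real.log θ / M) / M|
      have hZ : 0 ≤ Z := abs_nonneg _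
      have hp2 := Real.rpow_pos_of_pos h0 (-2*α-1-1)
      calc M * w0 * Z * (1/(M*θ)) = w0 * (1/θ) * Z := by field_simp
        _ = w0 * θ ^ (2*α+1) * (θ ^ (-2*α-1-1) * Z) := by rw [← hpw θ h0]; ring
        _ ≤ _ := by gcongr
  -- upper bound
  set g2 : ℝ → ℝ := fun x => M * w1 * (|V' x| / M + (2/M^2) * (K * |V x| + T * |k x|)) with hg2
  have cg2 : Continuous g2 :=
    continuous_const.mul ((cV'.abs.div_const M).add (continuous_const.mul
      ((continuous_const.mul cV.abs).add (continuous_const.mul c0.abs))))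
  have upp : ∫ θ in a..b, jW α β θ * |T * u θ - jDelta α β u θ| ≤
      ∫ x in (-2:ℝ)..(-1), g2 x := by
    rw [← log_sub M hM0 g2 cg2]
    refine intervalIntegral.integral_mono_on hab ?_ ?_ ?_
    · apply ContinuousOn.intervalIntegrable_of_Icc hab
      exact hWc.mul ((continuous_const.mul hucc.1.continuous).sub
        hDcc.1.continuous).abs.continuousOn
    · apply ContinuousOn.intervalIntegrable_of_Icc hab
      exact (cg2.comp_continuousOn hlogc).mul hinvc
    · intro θ hθ
      have h0 : 0 < θ := ha.trans_le hθ.1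
      have hθ1 : θ ≤ 1 := hθ.2.trans hb1
      have h1 := (hW θ ⟨h0, hθ1⟩).2
      have h2 := hK θ ⟨h0, hθ1⟩
      simp only [hg2]
      unfold jDelta
      rw [ddu θ h0, du θ h0, hu_pos θ h0]
      set x := Real.log θ / M
      have hp2 := Real.rpow_pos_of_pos h0 (-2*α-1-1)
      have q1 : θ ^ (-2*α-1) = θ ^ (-2*α-1-1) * θ := by
        rw [← Real.rpow_add_one h0.ne']; ring_nf
      have q2 : θ ^ (-2*α) = θ ^ (-2*α-1-1) * θ * θ := by
        rw [← Real.rpow_add_one h0.ne', ← Real.rpow_add_one h0.ne']; ring_nf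
      rw [q1, q2]
      set P := θ ^ (-2*α-1-1)
      have e : T * (P * θ * θ * k x) - (P * ((-2*α-1) * V x + V' x / M) +
          jD α β θ * (P * θ * V x)) =
          P * (T * (θ * θ) * k x - V' x / M - (θ * jD α β θ - (2*α+1)) * V x) := by ring
      rw [e, abs_mul, abs_of_pos hp2]
      have hθM : θ ≤ 2/M^2 := hθ.2.trans hbM
      have b1 : |T * (θ * θ) * k x - V' x / M - (θ * jD α β θ - (2*α+1)) * V x| ≤
          |V' x| / M + (2/M^2) * (K * |V x| + T * |k x|) := by
        have s1 : |T * (θ * θ) * k x| ≤ T * (2/M^2) * |k x| := by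
          rw [abs_mul, abs_of_nonneg (by positivity)]
          gcongr
          nlinarith
        have s2 : |V' x / M| = |V' x| / M := by rw [abs_div, abs_of_pos hM0]
        have s3 : |(θ * jD α β θ - (2*α+1)) * V x| ≤ K * (2/M^2) * |V x| := by
          rw [abs_mul]
          gcongr
          exact h2.trans (by gcongr)
        calc _ ≤ |T * (θ * θ) * k x| + |V' x / M| + |(θ * jD α β θ - (2*α+1)) * V x| :=
              (abs_sub _ _).trans (by gcongr; exact abs_sub _ _)
          _ ≤ T * (2/M^2) * |k x| + |V' x| / M + K * (2/M^2) * |V x| := by rw [s2]; gcongr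
          _ = _ := by ring
      set Z := |V' x| / M + (2/M^2) * (K * |V x| + T * |k x|)
      have hZ : 0 ≤ Z := by positivity
      calc jW α β θ * (P * _) ≤ (w1 * θ ^ (2*α+1)) * (P * Z) := by gcongr
        _ = w1 * (θ ^ (2*α+1) * P) * Z := by ring
        _ = w1 * (1/θ) * Z := by rw [hpw θ h0]
        _ = _ := by field_simp
  -- bounds for integrals
  have bV : ∀ x ∈ Icc (-2:ℝ) (-1), |V x| ≤ 2*|α| * B + B := by
    intro x hx
    obtain ⟨e0, e1, e2⟩ := hB x hx
    simp only [hV]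
    refine (abs_add_le _ _).trans ?_
    rw [abs_mul, abs_mul, abs_div, abs_of_pos hM0]
    have : |k1 x| / M ≤ B := (div_le_self (abs_nonneg _) hM).trans e1
    norm_num
    gcongr
  have bV' : ∀ x ∈ Icc (-2:ℝ) (-1), |V' x| / M ≤ 2*B*(|α|/M) + B*(1/M^2) := by
    intro x hx
    obtain ⟨e0, e1, e2⟩ := hB x hx
    have : |V' x| ≤ 2*|α| * B + B/M := by
      simp only [hV']
      refine (abs_add_le _ _).trans ?_
      rw [abs_mul, abs_mul, abs_div, abs_of_pos hM0]
      norm_num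
      gcongr
    calc |V' x| / M ≤ (2*|α| * B + B/M) / M := by gcongr
      _ = _ := by field_simp
  have I2 : ∫ x in (-2:ℝ)..(-1), g2 x ≤ M * w1 * (E2 * (|α|/M + 1/M^2)) := by
    have : M * w1 * (E2 * (|α|/M + 1/M^2)) = ∫ x in (-2:ℝ)..(-1), M * w1 * (E2 * (|α|/M + 1/M^2)) := by
      rw [intervalIntegral.integral_const]; norm_num
    rw [this]
    refine intervalIntegral.integral_mono_on (by norm_num) (cg2.intervalIntegrable _ _)
      (continuous_const.intervalIntegrable _ _) fun x hx => ?_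
    simp only [hg2]
    have e1 := bV x hx
    have e2 := bV' x hx
    have e3 := (hB x hx).1
    have e4 : (2/M^2) * (K * |V x| + T * |k x|) ≤ (2/M^2) * (K * (2*|α| * B+B) + T * B) := by gcongr
    have hα0 : 0 ≤ |α|/M := by positivity
    have hM2 : 0 ≤ 1/M^2 := by positivity
    have e5 : 0 ≤ K*(2*|α| * B+B) + T*B := by positivity
    gcongr
    calc _ ≤ 2*B*(|α|/M) + B*(1/M^2) + (2/M^2) * (K * (2*|α| * B+B) + T * B) := by linarith
      _ = 2*B*(|α|/M) + (B + 2*(K * (2*|α| * B+B) + T * B))*(1/M^2) := by ring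
      _ ≤ E2 * (|α|/M) + E2 * (1/M^2) := by
        gcongr <;> simp only [hE2] <;> linarith
      _ = _ := by ring
  have I1 : M * w0 * (|2*α+1| * (∫ x in (-2:ℝ)..(-1), |V x|) - E2 * (|α|/M + 1/M^2)) ≤
      ∫ x in (-2:ℝ)..(-1), g1 x := by
    have : M * w0 * (|2*α+1| * (∫ x in (-2:ℝ)..(-1), |V x|) - E2 * (|α|/M + 1/M^2)) =
        ∫ x in (-2:ℝ)..(-1), M * w0 * (|2*α+1| * |V x| - E2 * (|α|/M + 1/M^2)) := by
      rw [intervalIntegral.integral_const_mul, intervalIntegral.integral_sub,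
        intervalIntegral.integral_const_mul, intervalIntegral.integral_const]
      · norm_num
      · exact (continuous_const.mul cV.abs).intervalIntegrable _ _
      · exact continuous_const.intervalIntegrable _ _
    rw [this]
    refine intervalIntegral.integral_mono_on (by norm_num)
      ((continuous_const.mul ((continuous_const.mul cV.abs).sub
        continuous_const)).intervalIntegrable _ _)
      (cg1.intervalIntegrable _ _) fun x hx => ?_
    simp only [hg1]
    have e2 := bV' x hx
    have hα0 : 0 ≤ |α|/M := by positivity
    have hM2 : 0 ≤ 1/M^2 := by positivity
    have e5 : 0 ≤ K*(2*|α| * B+B) + T*B := by positivity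
    have e6 : 2*B*(|α|/M) + B*(1/M^2) ≤ E2 * (|α|/M) + E2 * (1/M^2) := by
      gcongr <;> simp only [hE2] <;> linarith
    gcongr
    have e7 : |2*α+1| * |V x| ≤ |(-2*α-1) * V x + V' x / M| + |V' x / M| := by
      rw [← abs_mul]
      have : (2*α+1) * V x = -(((-2*α-1) * V x + V' x / M) - V' x / M) := by ring
      rw [this, abs_neg]
      exact abs_sub _ _
    rw [abs_div, abs_of_pos hM0] at e7
    linarith
  have fin : M * w0 * (|2*α+1| * (∫ x in (-2:ℝ)..(-1), |V x|) - E2 * (|α|/M + 1/M^2)) ≤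
      C * (M * w1 * (E2 * (|α|/M + 1/M^2))) := by
    refine (I1.trans low).trans (hmain.trans ?_)
    gcongr
    exact upp.trans I2
  set J := ∫ x in (-2:ℝ)..(-1), |V x|
  set R := |α|/M + 1/M^2
  have fin2 : w0 * (|2*α+1| * J - E2 * R) ≤ C * w1 * (E2 * R) := by
    have : M * (w0 * (|2*α+1| * J - E2 * R)) ≤ M * (C * w1 * (E2 * R)) := by linarith
    exact le_of_mul_le_mul_left this hM0
  have fin3 : |2*α+1| * J - E2 * R ≤ C * w1 * (E2 * R) / w0 := by
    rw [le_div_iff₀ hw0]; linarith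
  rw [div_mul_eq_mul_div, le_div_iff₀ hA]
  calc J * |2*α+1| ≤ C * w1 * (E2 * R) / w0 + E2 * R := by linarith
    _ = _ := by ring

lemma jFalse {α β : ℝ} (hα : α ≠ -1/2) (H : JIneq α β) : False := by
  let f : ContDiffBump (-3/2 : ℝ) := ⟨1/4, 1/2, by norm_num, by norm_num⟩
  set k : ℝ → ℝ := fun x => f x with hkdef
  have hk : ContDiff ℝ (⊤ : ℕ∞) k := f.contDiff
  have hkpos : ∀ x ∈ Ioo (-2:ℝ) (-1), 0 < k x := by
    intro x hx
    apply f.pos_of_mem_ball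
    rw [Real.ball_eq_Ioo]
    change x ∈ Ioo (-3/2 - 1/2 : ℝ) (-3/2 + 1/2)
    exact ⟨by linarith [hx.1], by linarith [hx.2]⟩
  have hkz : ∀ x, x ∉ Ioo (-2:ℝ) (-1) → k x = 0 := by
    intro x hx
    apply f.zero_of_le_dist
    change (1/2:ℝ) ≤ dist x (-3/2)
    by_contra h
    rw [not_le, Real.dist_eq, abs_lt] at h
    exact hx ⟨by linarith [h.1], by linarith [h.2]⟩
  have hk1 := contDiff_deriv_top hk
  have hk2 := contDiff_deriv_top hk1
  have d1 : ∀ x, HasDerivAt k (deriv k x) x := fun x => (hk.differentiable (by simp) x).hasDerivAt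
  have d2 : ∀ x, HasDerivAt (deriv k) (deriv (deriv k) x) x :=
    fun x => (hk1.differentiable (by simp) x).hasDerivAt
  obtain ⟨E, hE⟩ := jCore hα H hk (fun x hx => hkz x fun h => hx (Ioo_subset_Icc_self h)) d1 d2
    hk2.continuous
  have ck1 := hk1.continuous
  by_cases h0 : α = 0
  · subst h0
    set J := ∫ x in (-2:ℝ)..(-1), |deriv k x| with hJ
    have hJpos : 0 < J := by
      have h1 : ∫ x in (-2:ℝ)..(-3/2), deriv k x = k (-3/2) - k (-2) :=
        intervalIntegral.integral_eq_sub_of_hasDerivAt (fun x _ => d1 x)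
          (ck1.intervalIntegrable _ _)
      rw [hkz (-2) (by simp)] at h1
      have h2 := hkpos (-3/2) (by constructor <;> norm_num)
      have h3 : ∫ x in (-2:ℝ)..(-3/2), deriv k x ≤ ∫ x in (-2:ℝ)..(-3/2), |deriv k x| :=
        intervalIntegral.integral_mono_on (by norm_num) (ck1.intervalIntegrable _ _)
          (ck1.abs.intervalIntegrable _ _) fun x _ => le_abs_self _
      have h4 : ∫ x in (-2:ℝ)..(-3/2), |deriv k x| ≤ J := by
        rw [hJ]
        refine intervalIntegral.integral_mono_interval le_rfl (by norm_num) (by norm_num) ?_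
          (ck1.abs.intervalIntegrable _ _)
        exact Eventually.of_forall fun x => abs_nonneg _
      linarith
    have h1 : ∀ M : ℝ, 1 ≤ M → M * J ≤ E := by
      intro M hM
      have hM0 : 0 < M := by linarith
      have := hE M hM
      have e : ∀ x, |-2 * 0 * k x + deriv k x / M| = |deriv k x| * (1/M) := by
        intro x
        rw [mul_zero, zero_mul, zero_add, abs_div, abs_of_pos hM0]; ring
      simp only [e] at this
      rw [intervalIntegral.integral_mul_const, abs_zero, zero_div, zero_add] at this
      change J * (1/M) ≤ _ at this
      have h2 : M^2 * (J * (1/M)) ≤ M^2 * (E * (1/M^2)) := by gcongr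
      have e1 : M^2 * (J * (1/M)) = M * J := by field_simp
      have e2 : M^2 * (E * (1/M^2)) = E := by field_simp
      rwa [e1, e2] at h2
    have := h1 (max 1 (E/J + 1)) (le_max_left _ _)
    have h2 : (E/J + 1) * J ≤ max 1 (E/J + 1) * J := by gcongr; exact le_max_right _ _
    have h3 : (E/J + 1) * J = E + J := by field_simp
    linarith
  · have hα0 : 0 < |α| := abs_pos.2 h0
    set J := ∫ x in (-2:ℝ)..(-1), k x with hJ
    set J1 := ∫ x in (-2:ℝ)..(-1), |deriv k x| with hJ1
    have hJpos : 0 < J :=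
      intervalIntegral.intervalIntegral_pos_of_pos_on (hk.continuous.intervalIntegrable _ _)
        hkpos (by norm_num)
    have h1 : ∀ M : ℝ, 1 ≤ M → M * (2 * |α| * J) ≤ |E| * (|α| + 1) + J1 := by
      intro M hM
      have hM0 : 0 < M := by linarith
      have h2 := hE M hM
      have h3 : 2 * |α| * J - J1 / M ≤ ∫ x in (-2:ℝ)..(-1), |-2*α*k x + deriv k x / M| := by
        have : 2 * |α| * J - J1 / M =
            ∫ x in (-2:ℝ)..(-1), (2 * |α| * k x - |deriv k x| / M) := by
          rw [intervalIntegral.integral_sub, intervalIntegral.integral_const_mul,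
            intervalIntegral.integral_div]
          · exact (continuous_const.mul hk.continuous).intervalIntegrable _ _
          · exact (ck1.abs.div_const M).intervalIntegrable _ _
        rw [this]
        refine intervalIntegral.integral_mono_on (by norm_num)
          (((continuous_const.mul hk.continuous).sub (ck1.abs.div_const M)).intervalIntegrable _ _)
          (((continuous_const.mul hk.continuous).add (ck1.div_const M)).abs.intervalIntegrable _ _)
          fun x hx => ?_
        have e1 : 2 * |α| * k x ≤ |-2*α*k x| := by
          rw [abs_mul, abs_mul]
          norm_num
          gcongr
          exact le_abs_self _
        have e2 : |deriv k x| / M = |deriv k x / M| := by rw [abs_div, abs_of_pos hM0]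
        rw [e2]
        have e3 : |-2*α*k x| ≤ |-2*α*k x + deriv k x / M| + |deriv k x / M| := by
          have : -2*α*k x = (-2*α*k x + deriv k x / M) - deriv k x / M := by ring
          conv_lhs => rw [this]
          exact abs_sub _ _
        linarith
      have h4 : 2 * |α| * J ≤ E * (|α|/M + 1/M^2) + J1 / M := by linarith
      have h5 : E * (|α|/M + 1/M^2) ≤ |E| * (|α|/M + 1/M) := by
        have : 1/M^2 ≤ 1/M := by
          apply one_div_le_one_div_of_le hM0; nlinarith
        have hh : 0 ≤ |α|/M + 1/M^2 := by positivity
        calc _ ≤ |E| * (|α|/M + 1/M^2) := by gcongr; exact le_abs_self _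
          _ ≤ _ := by gcongr
      have h6 : M * (2 * |α| * J) ≤ M * (|E| * (|α|/M + 1/M) + J1/M) := by
        gcongr; linarith
      have e : M * (|E| * (|α|/M + 1/M) + J1/M) = |E| * (|α| + 1) + J1 := by field_simp
      rwa [e] at h6
    set R := |E| * (|α| + 1) + J1
    set Q := 2 * |α| * J
    have hQ : 0 < Q := by positivity
    have := h1 (max 1 (R/Q + 1)) (le_max_left _ _)
    have h2 : (R/Q + 1) * Q ≤ max 1 (R/Q + 1) * Q := by gcongr; exact le_max_right _ _
    have h3 : (R/Q + 1) * Q = R + Q := by field_simp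
    linarith

/-- for `(α,β) ≠ (−1/2,−1/2)`, the second-order Riesz-Jacobi transform `R_2`
is not bounded on `L¹(dμ_{α,β})`. -/
theorem riesz_jacobi_order_two_not_L1_bounded
    (α β : ℝ) (hα : -1 < α) (hβ : -1 < β) (hne : (α, β) ≠ (-1/2, -1/2))
    (c : ℕ → ℝ) (hc : JacobiNormalized α β c) :
    ¬ ∃ C : ℝ, ∀ f : ℝ → ℝ, IsCcSmooth f →
      ∫ θ, |rieszTransform α β c 2 f θ| ∂(jacobiMeasure α β) ≤
        C * ∫ θ, |f θ| ∂(jacobiMeasure α β) := by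
  intro H
  have hJ := jReduce hα hβ hc H
  by_cases h : α = -1/2
  · have hb : β ≠ -1/2 := fun hb => hne (by rw [h, hb])
    exact jFalse hb hJ.symm
  · exact jFalse h hJ

end
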